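/- arXiv:2409.02034 — 2 statements merged into one kernel-verified Lean document; each statement's English description precedes it below -/
import Mathlib

section
/- For every nonnegative integer n and integer k ≥ 2, b̅₅(5^k(n+3) − 3) = ((5^k − 1)/4)·b̅₅(5n+12) − ((5^k − 5)/4)·b̅₅(n). -/
open scoped BigOperators

/-- The q-Pochhammer infinite product `(a; q)_∞ = ∏_{k≥0} (1 - a q^k)`. -/
noncomputable def qpoch (a q : ℂ) : ℂ := ∏' k : ℕ, (1 - a * q ^ k)

/-- `φ(-q) = (q;q)_∞² / (q²;q²)_∞`. -/
noncomputable def phiNeg (q : ℂ) : ℂ := qpoch q q ^ 2 / qpoch (q ^ 2) (q ^ 2)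

/-- `ψ(-q) = (q;q)_∞ (q⁴;q⁴)_∞ / (q²;q²)_∞`. -/
noncomputable def psiNeg (q : ℂ) : ℂ :=
  qpoch q q * qpoch (q ^ 4) (q ^ 4) / qpoch (q ^ 2) (q ^ 2)

open Filter Topology

namespace Psi5

/-- Finite product of the quotients of even and odd factors. -/
noncomputable def P (n : ℕ) (x : ℂ) : ℂ :=
  ∏ k ∈ Finset.range n, (1 - x ^ (2 * k + 2)) / (1 - x ^ (2 * k + 1))

/-- Finite product `∏_{k<n} (1 - x^(k+1))`. -/
noncomputable def E (n : ℕ) (x : ℂ) : ℂ := ∏ k ∈ Finset.range n, (1 - x ^ (k + 1))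

lemma one_sub_ne {x : ℂ} (hx : ‖x‖ < 1) (k : ℕ) : 1 - x ^ (k + 1) ≠ 0 := by
  intro h
  have h1 : x ^ (k + 1) = 1 := (sub_eq_zero.mp h).symm
  have h2 : ‖x‖ ^ (k + 1) = 1 := by rw [← norm_pow, h1, norm_one]
  have h3 := pow_lt_one₀ (norm_nonneg x) hx (Nat.succ_ne_zero k)
  simp only [Nat.succ_eq_add_one] at h3
  linarith

lemma pow_lt {x : ℂ} (hx : ‖x‖ < 1) {k : ℕ} (hk : k ≠ 0) : ‖x ^ k‖ < 1 := by
  rw [norm_pow]; exact pow_lt_one₀ (norm_nonneg x) hx hk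

lemma P_zero (x : ℂ) : P 0 x = 1 := by simp [P]

lemma P_succ (n : ℕ) (x : ℂ) :
    P (n + 1) x = P n x * ((1 - x ^ (2 * n + 2)) / (1 - x ^ (2 * n + 1))) := by
  rw [P, Finset.prod_range_succ, P]

lemma P_ne {x : ℂ} (hx : ‖x‖ < 1) (n : ℕ) : P n x ≠ 0 := by
  rw [P, Finset.prod_ne_zero_iff]
  intro k _
  exact div_ne_zero (one_sub_ne hx (2 * k + 1)) (one_sub_ne hx (2 * k))

lemma E_ne {x : ℂ} (hx : ‖x‖ < 1) (n : ℕ) : E n x ≠ 0 := by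
  rw [E, Finset.prod_ne_zero_iff]
  intro k _
  exact one_sub_ne hx k

lemma qpoch_self (x : ℂ) : qpoch x x = ∏' k : ℕ, (1 - x ^ (k + 1)) := by
  unfold qpoch
  congr 1
  ext k
  ring

lemma summable_pow_succ {x : ℂ} (hx : ‖x‖ < 1) : Summable fun n : ℕ => ‖-x ^ (n + 1)‖ := by
  simpa using (summable_nat_add_iff 1).mpr (summable_geometric_of_lt_one (norm_nonneg _) hx)

lemma E_tendsto {x : ℂ} (hx : ‖x‖ < 1) : Tendsto (fun n => E n x) atTop (𝓝 (qpoch x x)) := by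
  rw [qpoch_self]
  have h : Multipliable fun n : ℕ => 1 - x ^ (n + 1) := by
    simpa [sub_eq_add_neg] using multipliable_one_add_of_summable (summable_pow_succ hx)
  exact h.hasProd.tendsto_prod_nat

lemma qpoch_ne {x : ℂ} (hx : ‖x‖ < 1) : qpoch x x ≠ 0 := by
  rw [qpoch_self]
  have := tprod_one_add_ne_zero_of_summable (f := fun n : ℕ => -x ^ (n + 1))
    (fun i => by simpa [sub_eq_add_neg] using one_sub_ne hx i) (summable_pow_succ hx)
  simpa [sub_eq_add_neg] using this

lemma psiNeg_ne {q : ℂ} (hq : ‖q‖ < 1) : psiNeg q ≠ 0 := by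
  unfold psiNeg
  exact div_ne_zero (mul_ne_zero (qpoch_ne hq) (qpoch_ne (pow_lt hq (by norm_num))))
    (qpoch_ne (pow_lt hq (by norm_num)))

lemma E_succ (n : ℕ) (x : ℂ) : E (n + 1) x = E n x * (1 - x ^ (n + 1)) := by
  simp [E, Finset.prod_range_succ]

lemma P_eq_E {q : ℂ} (hq : ‖q‖ < 1) (n : ℕ) :
    P n (-q) = E (2 * n) q * E n (q ^ 4) / E (2 * n) (q ^ 2) := by
  induction n with
  | zero => simp [P, E]
  | succ n ih =>
    have h2 : ‖q ^ 2‖ < 1 := pow_lt hq (by norm_num)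
    have hm : ‖-q‖ < 1 := by simpa using hq
    rw [P_succ, ih, show 2 * (n + 1) = 2 * n + 1 + 1 by ring]
    simp only [E_succ]
    have a1 := E_ne h2 (2 * n)
    have a2 := one_sub_ne h2 (2 * n)
    have a3 := one_sub_ne h2 (2 * n + 1)
    have a4 := one_sub_ne hm (2 * n)
    have e1 : (-q) ^ (2 * n + 1) = - q ^ (2 * n + 1) := by
      rw [Odd.neg_pow ⟨n, rfl⟩]
    have e2 : (-q) ^ (2 * n + 2) = q ^ (2 * n + 2) := by
      rw [Even.neg_pow ⟨n + 1, by ring⟩]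
    rw [e1] at a4
    rw [e1, e2]
    have e3 : (1 : ℂ) - (q ^ 2) ^ (2 * n + 1) = (1 - q ^ (2 * n + 1)) * (1 - -q ^ (2 * n + 1)) := by
      ring
    have e4 : (1 : ℂ) - (q ^ 4) ^ (n + 1) = 1 - (q ^ 2) ^ (2 * n + 1 + 1) := by ring
    rw [e4, e3]
    rw [e3] at a2
    have a5 : (1 : ℂ) - q ^ (2 * n + 1) ≠ 0 := one_sub_ne hq (2 * n)
    generalize (1 : ℂ) - (q ^ 2) ^ (2 * n + 1 + 1) = w at *
    generalize (1 : ℂ) - q ^ (2 * n + 1) = w1 at *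
    generalize (1 : ℂ) - -q ^ (2 * n + 1) = w2 at *
    field_simp

lemma P_tendsto_psiNeg {q : ℂ} (hq : ‖q‖ < 1) :
    Tendsto (fun n => P n (-q)) atTop (𝓝 (psiNeg q)) := by
  have h2 : ‖q ^ 2‖ < 1 := pow_lt hq (by norm_num)
  have h4 : ‖q ^ 4‖ < 1 := pow_lt hq (by norm_num)
  have t : Tendsto (fun n : ℕ => 2 * n) atTop atTop :=
    Filter.tendsto_id.const_mul_atTop' (by norm_num)
  simp_rw [P_eq_E hq]
  exact (((E_tendsto hq).comp t).mul (E_tendsto h4)).div ((E_tendsto h2).comp t) (qpoch_ne h2)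

lemma shanks {x : ℂ} (hx : ‖x‖ < 1) (n : ℕ) :
    ∑ s ∈ Finset.range n, P n x / P s x * x ^ (s * (2 * n + 1)) =
      ∑ s ∈ Finset.range (2 * n), x ^ (s * (s + 1) / 2) := by
  induction n with
  | zero => simp
  | succ n ih =>
    have hn := one_sub_ne hx (2 * n)
    have hP := P_ne hx n
    have key : ∀ m : ℕ, ∑ s ∈ Finset.range m, (P (n + 1) x / P s x * x ^ (s * (2 * (n + 1) + 1)) -
        P n x / P s x * x ^ (s * (2 * n + 1))) =
        P n x / ((1 - x ^ (2 * n + 1)) * P m x) * x ^ (m * (2 * n + 1)) * (1 - x ^ (2 * m)) := by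
      intro m
      induction m with
      | zero => simp
      | succ m ihm =>
        rw [Finset.sum_range_succ, ihm, P_succ, P_succ m]
        have a1 := P_ne hx m
        have a2 := one_sub_ne hx (2 * m)
        have a3 := one_sub_ne hx (2 * m + 1)
        simp only [show 2 * m + 1 + 1 = 2 * m + 2 by ring, show 2 * (m + 1) = 2 * m + 2 by ring] at *
        field_simp
        ring
    have h1 := key n
    rw [Finset.sum_sub_distrib, ih] at h1
    rw [Finset.sum_range_succ, show 2 * (n + 1) = 2 * n + 1 + 1 by ring,
      Finset.sum_range_succ, Finset.sum_range_succ, ← show 2 * (n + 1) = 2 * n + 1 + 1 by ring,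
      sub_eq_iff_eq_add.mp h1, P_succ]
    have d1 : 2 * n * (2 * n + 1) / 2 = n * (2 * n + 1) := by
      rw [show 2 * n * (2 * n + 1) = 2 * (n * (2 * n + 1)) by ring]; simp
    have d2 : (2 * n + 1) * (2 * n + 1 + 1) / 2 = (2 * n + 1) * (n + 1) := by
      rw [show (2 * n + 1) * (2 * n + 1 + 1) = 2 * ((2 * n + 1) * (n + 1)) by ring]; simp
    rw [show 2 * (n + 1) = 2 * n + 1 + 1 by ring, d1, d2]
    field_simp
    ring


lemma shanks_tendsto {x L : ℂ} (hx : ‖x‖ < 1) (hL : L ≠ 0)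
    (hP : Tendsto (fun n => P n x) atTop (𝓝 L)) :
    Tendsto (fun n : ℕ => ∑ s ∈ Finset.range (2 * n), x ^ (s * (s + 1) / 2)) atTop (𝓝 L) := by
  simp_rw [← shanks hx]
  obtain ⟨M1, hM1⟩ := (Metric.isBounded_range_of_tendsto _ hP).exists_norm_le
  obtain ⟨M2, hM2⟩ := (Metric.isBounded_range_of_tendsto _ (hP.inv₀ hL)).exists_norm_le
  have hM1' : ∀ n, ‖P n x‖ ≤ M1 := fun n => hM1 _ ⟨n, rfl⟩
  have hM2' : ∀ n, ‖(P n x)⁻¹‖ ≤ M2 := fun n => hM2 _ ⟨n, rfl⟩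
  have hM1p : 0 ≤ M1 := (norm_nonneg _).trans (hM1' 0)
  have hM2p : 0 ≤ M2 := (norm_nonneg _).trans (hM2' 0)
  have h0 : Tendsto (fun n : ℕ => (∑ s ∈ Finset.range n, P n x / P s x * x ^ (s * (2 * n + 1)))
      - P n x) atTop (𝓝 0) := by
    rw [← tendsto_add_atTop_iff_nat 1]
    apply squeeze_zero_norm (a := fun n : ℕ => M1 * M2 * (n * ‖x‖ ^ n))
    · intro n
      rw [Finset.sum_range_succ', P_zero]
      simp only [zero_mul, pow_zero, div_one, mul_one, add_sub_cancel_right]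
      calc _ ≤ ∑ s ∈ Finset.range n, M1 * M2 * ‖x‖ ^ n := by
            apply norm_sum_le_of_le
            intro s _
            rw [norm_mul, div_eq_mul_inv, norm_mul, norm_pow]
            have : ‖x‖ ^ ((s + 1) * (2 * (n + 1) + 1)) ≤ ‖x‖ ^ n :=
              pow_le_pow_of_le_one (norm_nonneg _) hx.le (by nlinarith)
            gcongr
            · exact hM1' _
            · exact hM2' _
        _ = _ := by simp; ring
    · have := tendsto_self_mul_const_pow_of_lt_one (norm_nonneg x) hx
      simpa using this.const_mul (M1 * M2)
  simpa using h0.add hP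

/-- Triangular numbers, indexed by the integers. -/
def tri (n : ℤ) : ℕ := (n * (n + 1) / 2).toNat

/-- The first family of exponents. -/
def ea (n : ℤ) : ℕ := (n * (5 * n + 1) / 2).toNat

/-- The second family of exponents. -/
def eb (n : ℤ) : ℕ := (n * (5 * n + 3) / 2).toNat

lemma two_tri (n : ℤ) : 2 * (tri n : ℤ) = n * (n + 1) := by
  have h1 : 2 ∣ n * (n + 1) := by
    rcases Int.even_or_odd' n with ⟨k, rfl | rfl⟩
    · exact ⟨k * (2 * k + 1), by ring⟩
    · exact ⟨(2 * k + 1) * (k + 1), by ring⟩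
  have h2 : 0 ≤ n * (n + 1) := by
    rcases le_or_gt 0 n with h | h <;> nlinarith
  unfold tri
  omega

lemma two_ea (n : ℤ) : 2 * (ea n : ℤ) = n * (5 * n + 1) := by
  have h1 : 2 ∣ n * (5 * n + 1) := by
    rcases Int.even_or_odd' n with ⟨k, rfl | rfl⟩
    · exact ⟨k * (5 * (2 * k) + 1), by ring⟩
    · exact ⟨(2 * k + 1) * (5 * k + 3), by ring⟩
  have h2 : 0 ≤ n * (5 * n + 1) := by
    rcases le_or_gt 0 n with h | h <;> nlinarith
  unfold ea
  omega

lemma two_eb (n : ℤ) : 2 * (eb n : ℤ) = n * (5 * n + 3) := by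
  have h1 : 2 ∣ n * (5 * n + 3) := by
    rcases Int.even_or_odd' n with ⟨k, rfl | rfl⟩
    · exact ⟨k * (5 * (2 * k) + 3), by ring⟩
    · exact ⟨(2 * k + 1) * (5 * k + 4), by ring⟩
  have h2 : 0 ≤ n * (5 * n + 3) := by
    rcases le_or_gt 0 n with h | h <;> nlinarith
  unfold eb
  omega

lemma tri_ge (n : ℤ) : n.natAbs ≤ tri n + 1 := by
  have := two_tri n
  zify
  rcases abs_cases n with ⟨h, _⟩ | ⟨h, _⟩ <;> rw [h] <;> nlinarith [sq_nonneg (2 * n - 1), sq_nonneg (2 * n + 3)]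

lemma ea_ge (n : ℤ) : n.natAbs ≤ ea n + 1 := by
  have := two_ea n
  zify
  rcases abs_cases n with ⟨h, _⟩ | ⟨h, _⟩ <;> rw [h] <;> nlinarith

lemma eb_ge (n : ℤ) : n.natAbs ≤ eb n + 1 := by
  have := two_eb n
  zify
  rcases abs_cases n with ⟨h, _⟩ | ⟨h, _⟩ <;> rw [h] <;> nlinarith

lemma summable_exp {x : ℂ} (hx : ‖x‖ < 1) (e : ℤ → ℕ) (he : ∀ n, n.natAbs ≤ e n + 1) :
    Summable fun n : ℤ => ‖x ^ e n‖ := by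
  set r : ℝ := max ‖x‖ (1 / 2) with hr
  have r1 : r < 1 := max_lt hx (by norm_num)
  have r0 : 0 < r := lt_of_lt_of_le (by norm_num) (le_max_right _ _)
  have hs : Summable fun n : ℤ => r⁻¹ * r ^ n.natAbs := by
    apply Summable.mul_left
    rw [summable_int_iff_summable_nat_and_neg]
    constructor <;> simpa using summable_geometric_of_lt_one r0.le r1
  refine Summable.of_nonneg_of_le (fun _ => norm_nonneg _) (fun n => ?_) hs
  rw [norm_pow]
  calc ‖x‖ ^ e n ≤ r ^ e n := by gcongr; exact le_max_left _ _
    _ = r⁻¹ * r ^ (e n + 1) := by rw [pow_succ]; field_simp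
    _ ≤ r⁻¹ * r ^ n.natAbs := by
      gcongr ?_ * ?_
      exact pow_le_pow_of_le_one r0.le r1.le (he n)

/-- `∑_{n ∈ ℤ} x^{n(n+1)/2} = 2 ψ(x)`. -/
noncomputable def Th (x : ℂ) : ℂ := ∑' n : ℤ, x ^ tri n

/-- `f(x^2, x^3)`. -/
noncomputable def TA (x : ℂ) : ℂ := ∑' n : ℤ, x ^ ea n

/-- `f(x, x^4)`. -/
noncomputable def TB (x : ℂ) : ℂ := ∑' n : ℤ, x ^ eb n

lemma hTh {x : ℂ} (hx : ‖x‖ < 1) : HasSum (fun n : ℤ => x ^ tri n) (Th x) :=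
  (summable_exp hx tri tri_ge).of_norm.hasSum

lemma hTA {x : ℂ} (hx : ‖x‖ < 1) : HasSum (fun n : ℤ => x ^ ea n) (TA x) :=
  (summable_exp hx ea ea_ge).of_norm.hasSum

lemma hTB {x : ℂ} (hx : ‖x‖ < 1) : HasSum (fun n : ℤ => x ^ eb n) (TB x) :=
  (summable_exp hx eb eb_ge).of_norm.hasSum

lemma Th_eq {x L : ℂ} (hx : ‖x‖ < 1) (hL : L ≠ 0)
    (hP : Tendsto (fun n => P n x) atTop (𝓝 L)) : Th x = 2 * L := by
  have hs := (summable_exp hx tri tri_ge).of_norm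
  have hN : Summable fun n : ℕ => x ^ tri n := hs.comp_injective Nat.cast_injective
  have t : Tendsto (fun n : ℕ => 2 * n) atTop atTop :=
    Filter.tendsto_id.const_mul_atTop' (by norm_num)
  have h1 := hN.hasSum.tendsto_sum_nat.comp t
  have h2 := shanks_tendsto hx hL hP
  have e : ∀ n : ℕ, tri (n : ℤ) = n * (n + 1) / 2 := by
    intro n
    have := two_tri n
    have h : 2 * tri (n : ℤ) = n * (n + 1) := by exact_mod_cast this
    omega
  have h3 : HasSum (fun n : ℕ => x ^ tri n) L := by
    have : ∑' n : ℕ, x ^ tri n = L := by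
      refine tendsto_nhds_unique h1 ?_
      simpa [Function.comp_def, e] using h2
    rw [← this]; exact hN.hasSum
  have h4 : HasSum (fun n : ℕ => x ^ tri (-(n + 1 : ℤ))) L := by
    convert h3 using 3 with n
    have a := two_tri n
    have b := two_tri (-(n + 1 : ℤ))
    have : (tri (-(n + 1 : ℤ)) : ℤ) = tri n := by linarith
    exact_mod_cast this
  have h5 := HasSum.of_nat_of_neg_add_one (f := fun n : ℤ => x ^ tri n) h3 h4
  rw [Th, h5.tsum_eq]; ring

/-- Decomposition of the integers modulo 5. -/
def e1 : ℤ × Fin 5 ≃ ℤ where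
  toFun p := 5 * p.1 + (p.2.val : ℤ)
  invFun n := (n / 5, ⟨(n % 5).toNat, by omega⟩)
  left_inv := by
    rintro ⟨m, i, hi⟩
    simp only [Prod.mk.injEq, Fin.mk.injEq]
    omega
  right_inv := by
    intro n
    simp only
    omega

/-- Decomposition of `ℤ × ℤ` modulo the sublattice generated by `(2,1)` and `(1,-2)`. -/
def e2 : (ℤ × ℤ) × Fin 5 ≃ ℤ × ℤ where
  toFun p := (2 * p.1.1 + p.1.2 + (p.2.val : ℤ), p.1.1 - 2 * p.1.2)
  invFun n := ((n.2 + 2 * ((n.1 - 2 * n.2) / 5), (n.1 - 2 * n.2) / 5),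
    ⟨((n.1 - 2 * n.2) % 5).toNat, by omega⟩)
  left_inv := by
    rintro ⟨⟨a, b⟩, i, hi⟩
    simp only [Prod.mk.injEq, Fin.mk.injEq]
    omega
  right_inv := by
    rintro ⟨m, n⟩
    simp only [Prod.mk.injEq]
    omega

lemma hasSum_fin5 {α : Type*} {f : α × Fin 5 → ℂ} {s : ℂ} (hf : HasSum f s)
    {t : Fin 5 → ℂ} (ht : ∀ i, HasSum (fun a => f (a, i)) (t i)) :
    s = t 0 + t 1 + t 2 + t 3 + t 4 := by
  have h1 : HasSum (fun p : Fin 5 × α => f (p.2, p.1)) s :=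
    (Equiv.prodComm (Fin 5) α).hasSum_iff.mpr hf
  have h2 := h1.prod_fiberwise ht
  have h3 := h2.unique (hasSum_fintype t)
  rw [h3, Fin.sum_univ_five]

lemma hs_congr {α : Type*} {f g : α → ℂ} {s : ℂ} (h : HasSum f s) (e : ∀ a, g a = f a) :
    HasSum g s := by
  rwa [funext e]

lemma Th_dissect {x : ℂ} (hx : ‖x‖ < 1) :
    Th x = 2 * TA (x ^ 5) + 2 * (x * TB (x ^ 5)) + x ^ 3 * Th (x ^ 25) := by
  have h5 : ‖x ^ 5‖ < 1 := pow_lt hx (by norm_num)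
  have h25 : ‖x ^ 25‖ < 1 := pow_lt hx (by norm_num)
  have h := e1.hasSum_iff.mpr (hTh hx)
  have neg : ∀ {f : ℤ → ℂ} {s : ℂ}, HasSum f s → HasSum (fun n => f (-1 - n)) s :=
    fun hf => (Equiv.subLeft (-1 : ℤ)).hasSum_iff.mpr hf
  have r := hasSum_fin5 h (t := ![TA (x ^ 5), x * TB (x ^ 5), x ^ 3 * Th (x ^ 25),
    x * TB (x ^ 5), TA (x ^ 5)]) (by
    intro i
    fin_cases i
    · refine hs_congr (hTA h5) (fun n => ?_)
      simp only [Function.comp, e1, Equiv.coe_fn_mk, ← pow_mul]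
      congr 1
      have a := two_tri (5 * n + 0)
      have b := two_ea n
      zify
      linarith
    · refine hs_congr ((hTB h5).mul_left x) (fun n => ?_)
      simp only [Function.comp, e1, Equiv.coe_fn_mk, ← pow_mul, ← pow_succ']
      congr 1
      have a := two_tri (5 * n + 1)
      have b := two_eb n
      zify
      linarith
    · refine hs_congr ((hTh h25).mul_left (x ^ 3)) (fun n => ?_)
      simp only [Function.comp, e1, Equiv.coe_fn_mk, ← pow_mul, ← pow_add]
      congr 1
      have a := two_tri (5 * n + 2)
      have b := two_tri n
      zify
      linarith
    · refine hs_congr ((neg (hTB h5)).mul_left x) (fun n => ?_)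
      simp only [Function.comp, e1, Equiv.coe_fn_mk, ← pow_mul, ← pow_succ']
      congr 1
      have a := two_tri (5 * n + 3)
      have b := two_eb (-1 - n)
      zify
      linarith
    · refine hs_congr (neg (hTA h5)) (fun n => ?_)
      simp only [Function.comp, e1, Equiv.coe_fn_mk, ← pow_mul]
      congr 1
      have a := two_tri (5 * n + 4)
      have b := two_ea (-1 - n)
      zify
      linarith)
  rw [r]
  simp
  ring

lemma prod_hasSum {f g : ℤ → ℂ} {s t : ℂ} (hf : HasSum f s) (hg : HasSum g t) :
    HasSum (fun p : ℤ × ℤ => f p.1 * g p.2) (s * t) := by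
  have a := hf.summable.norm
  have b := hg.summable.norm
  exact hf.mul hg (summable_mul_of_summable_norm a b)

lemma Th_sq {y : ℂ} (hy : ‖y‖ < 1) :
    Th y ^ 2 = 4 * (TA y * TB y) + y * Th (y ^ 5) ^ 2 := by
  have h5 : ‖y ^ 5‖ < 1 := pow_lt hy (by norm_num)
  have h := e2.hasSum_iff.mpr (prod_hasSum (hTh hy) (hTh hy))
  have refl : ∀ {f : ℤ → ℂ} {s : ℂ} (k : ℤ), HasSum f s → HasSum (fun n => f (k - n)) s :=
    fun k hf => (Equiv.subLeft k).hasSum_iff.mpr hf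
  have tr : ∀ {f : ℤ → ℂ} {s : ℂ} (k : ℤ), HasSum f s → HasSum (fun n => f (n + k)) s :=
    fun k hf => (Equiv.addRight k).hasSum_iff.mpr hf
  have r := hasSum_fin5 h (t := ![TB y * TA y, TB y * TA y, TA y * TB y,
    y * (Th (y ^ 5) * Th (y ^ 5)), TA y * TB y]) (by
    intro i
    fin_cases i
    · refine hs_congr (prod_hasSum (hTB hy) (refl 0 (hTA hy))) (fun p => ?_)
      obtain ⟨a, b⟩ := p
      simp only [Function.comp, e2, Equiv.coe_fn_mk, ← pow_add]
      congr 1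
      have a1 := two_tri (2 * a + b + 0)
      have a2 := two_tri (a - 2 * b)
      have a3 := two_eb a
      have a4 := two_ea (0 - b)
      zify
      linarith
    · refine hs_congr (prod_hasSum (refl (-1) (hTB hy)) (hTA hy)) (fun p => ?_)
      obtain ⟨a, b⟩ := p
      simp only [Function.comp, e2, Equiv.coe_fn_mk, ← pow_add]
      congr 1
      have a1 := two_tri (2 * a + b + 1)
      have a2 := two_tri (a - 2 * b)
      have a3 := two_eb (-1 - a)
      have a4 := two_ea b
      zify
      linarith
    · refine hs_congr (prod_hasSum (tr 1 (hTA hy)) (hTB hy)) (fun p => ?_)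
      obtain ⟨a, b⟩ := p
      simp only [Function.comp, e2, Equiv.coe_fn_mk, ← pow_add]
      congr 1
      have a1 := two_tri (2 * a + b + 2)
      have a2 := two_tri (a - 2 * b)
      have a3 := two_ea (a + 1)
      have a4 := two_eb b
      zify
      linarith
    · refine hs_congr ((prod_hasSum (tr 1 (hTh h5)) (hTh h5)).mul_left y) (fun p => ?_)
      obtain ⟨a, b⟩ := p
      simp only [Function.comp, e2, Equiv.coe_fn_mk, ← pow_add, ← pow_mul, ← pow_succ']
      congr 1
      have a1 := two_tri (2 * a + b + 3)
      have a2 := two_tri (a - 2 * b)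
      have a3 := two_tri (a + 1)
      have a4 := two_tri b
      zify
      linarith
    · refine hs_congr (prod_hasSum (refl (-2) (hTA hy)) (refl (-1) (hTB hy))) (fun p => ?_)
      obtain ⟨a, b⟩ := p
      simp only [Function.comp, e2, Equiv.coe_fn_mk, ← pow_add]
      congr 1
      have a1 := two_tri (2 * a + b + 4)
      have a2 := two_tri (a - 2 * b)
      have a3 := two_ea (-2 - a)
      have a4 := two_eb (-1 - b)
      zify
      linarith)
  rw [sq, r]
  simp
  ring

/-- `ψ(x)`. -/
noncomputable def Psi (x : ℂ) : ℂ := psiNeg (-x)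

lemma Psi_ne {x : ℂ} (hx : ‖x‖ < 1) : Psi x ≠ 0 := psiNeg_ne (by simpa using hx)

lemma P_tendsto {x : ℂ} (hx : ‖x‖ < 1) : Tendsto (fun n => P n x) atTop (𝓝 (Psi x)) := by
  have := P_tendsto_psiNeg (q := -x) (by simpa using hx)
  simpa [Psi] using this

lemma Th_Psi {x : ℂ} (hx : ‖x‖ < 1) : Th x = 2 * Psi x := Th_eq hx (Psi_ne hx) (P_tendsto hx)

lemma Psi_dissect {x : ℂ} (hx : ‖x‖ < 1) :
    Psi x = TA (x ^ 5) + x * TB (x ^ 5) + x ^ 3 * Psi (x ^ 25) := by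
  have h := Th_dissect hx
  rw [Th_Psi hx, Th_Psi (pow_lt hx (by norm_num))] at h
  linear_combination h / 2

lemma Psi_sq {y : ℂ} (hy : ‖y‖ < 1) :
    Psi y ^ 2 = TA y * TB y + y * Psi (y ^ 5) ^ 2 := by
  have h := Th_sq hy
  rw [Th_Psi hy, Th_Psi (pow_lt hy (by norm_num))] at h
  linear_combination h / 4

section norm

variable {z x : ℂ}

lemma z5 (hz : 1 + z + z ^ 2 + z ^ 3 + z ^ 4 = 0) : z ^ 5 = 1 := by
  linear_combination (z - 1) * hz

lemma z_norm (hz : 1 + z + z ^ 2 + z ^ 3 + z ^ 4 = 0) : ‖z‖ = 1 := by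
  have h : ‖z‖ ^ 5 = 1 := by rw [← norm_pow, z5 hz, norm_one]
  exact (pow_eq_one_iff_of_nonneg (norm_nonneg z) (by norm_num)).mp h

lemma zx_norm (hz : 1 + z + z ^ 2 + z ^ 3 + z ^ 4 = 0) (hx : ‖x‖ < 1) (j : ℕ) :
    ‖z ^ j * x‖ < 1 := by
  rw [norm_mul, norm_pow, z_norm hz]; simpa using hx

/-- Norm of `1 - x^m`. -/
noncomputable def PD (z x : ℂ) (m : ℕ) : ℂ := ∏ j ∈ Finset.range 5, (1 - (z ^ j * x) ^ m)

/-- Norm of `P n x`. -/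
noncomputable def PP (z x : ℂ) (n : ℕ) : ℂ := ∏ j ∈ Finset.range 5, P n (z ^ j * x)

lemma PP_succ (n : ℕ) : PP z x (n + 1) = PP z x n * (PD z x (2 * n + 2) / PD z x (2 * n + 1)) := by
  unfold PP PD
  rw [← Finset.prod_div_distrib, ← Finset.prod_mul_distrib]
  exact Finset.prod_congr rfl fun j _ => P_succ _ _

lemma PD_mul (hz : 1 + z + z ^ 2 + z ^ 3 + z ^ 4 = 0) (m : ℕ) :
    PD z x (5 * m) = (1 - (x ^ 5) ^ m) ^ 5 := by
  have h5 := z5 hz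
  unfold PD
  rw [Finset.prod_congr rfl (g := fun _ => 1 - (x ^ 5) ^ m)]
  · simp
  · intro j _
    rw [pow_mul, mul_pow, ← pow_mul z, mul_comm j 5, pow_mul z, h5, one_pow, one_mul]

lemma PD_add (hz : 1 + z + z ^ 2 + z ^ 3 + z ^ 4 = 0) (m i : ℕ) (hi : i = 1 ∨ i = 2 ∨ i = 3 ∨ i = 4) :
    PD z x (5 * m + i) = 1 - (x ^ 5) ^ (5 * m + i) := by
  have h5 := z5 hz
  have hj : ∀ j : ℕ, (z ^ j * x) ^ (5 * m + i) = z ^ (j * i) * x ^ (5 * m + i) := by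
    intro j
    rw [mul_pow, ← pow_mul z, show j * (5 * m + i) = 5 * (m * j) + j * i by ring, pow_add, pow_mul z 5, h5,
      one_pow, one_mul]
  unfold PD
  simp_rw [hj]
  rw [← pow_mul, mul_comm 5 (5 * m + i), pow_mul]
  generalize x ^ (5 * m + i) = w
  have base : ∀ v : ℂ, 1 + v + v ^ 2 + v ^ 3 + v ^ 4 = 0 → 
      (1 - w) * (1 - v * w) * (1 - v ^ 2 * w) * (1 - v ^ 3 * w) * (1 - v ^ 4 * w) = 1 - w ^ 5 := by
    intro v hv
    have v5 := z5 hv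
    grind
  have := base (z ^ i) (by rcases hi with rfl | rfl | rfl | rfl <;> grind)
  simp only [Finset.prod_range_succ, Finset.prod_range_zero, zero_mul, one_mul, pow_zero]
  rw [← this]
  ring

lemma PP_eq (hz : 1 + z + z ^ 2 + z ^ 3 + z ^ 4 = 0) (hx : ‖x‖ < 1) (k : ℕ) :
    PP z x (5 * k) * P k (x ^ 25) = P (5 * k) (x ^ 5) * P k (x ^ 5) ^ 5 := by
  induction k with
  | zero => simp [PP, P_zero]
  | succ k ih =>
    have h5 : ‖x ^ 5‖ < 1 := pow_lt hx (by norm_num)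
    rw [show 5 * (k + 1) = 5 * k + 1 + 1 + 1 + 1 + 1 by ring]
    simp only [PP_succ, P_succ]
    have p1 := PD_add (x := x) hz (2 * k) 1 (by norm_num)
    have p2 := PD_add (x := x) hz (2 * k) 2 (by norm_num)
    have p3 := PD_add (x := x) hz (2 * k) 3 (by norm_num)
    have p4 := PD_add (x := x) hz (2 * k) 4 (by norm_num)
    have p5 := PD_mul (x := x) hz (2 * k + 1)
    have p6 := PD_add (x := x) hz (2 * k + 1) 1 (by norm_num)
    have p7 := PD_add (x := x) hz (2 * k + 1) 2 (by norm_num)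
    have p8 := PD_add (x := x) hz (2 * k + 1) 3 (by norm_num)
    have p9 := PD_add (x := x) hz (2 * k + 1) 4 (by norm_num)
    have p10 := PD_mul (x := x) hz (2 * k + 2)
    have n1 := one_sub_ne h5 (10 * k)
    have n3 := one_sub_ne h5 (10 * k + 2)
    have n5 := one_sub_ne h5 (10 * k + 4)
    have n7 := one_sub_ne h5 (10 * k + 6)
    have n9 := one_sub_ne h5 (10 * k + 8)
    have m1 := one_sub_ne h5 (2 * k)
    have s1 : (x ^ 25) ^ (2 * k + 1) = (x ^ 5) ^ (10 * k + 5) := by ring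
    have s2 : (x ^ 25) ^ (2 * k + 2) = (x ^ 5) ^ (10 * k + 10) := by ring
    rw [s1, s2]
    rw [show 5 * (2 * k) + 1 = 10 * k + 1 by ring] at p1
    rw [show 5 * (2 * k) + 2 = 10 * k + 2 by ring] at p2
    rw [show 5 * (2 * k) + 3 = 10 * k + 3 by ring] at p3
    rw [show 5 * (2 * k) + 4 = 10 * k + 4 by ring] at p4
    rw [show 5 * (2 * k + 1) = 10 * k + 5 by ring] at p5
    rw [show 5 * (2 * k + 1) + 1 = 10 * k + 6 by ring] at p6
    rw [show 5 * (2 * k + 1) + 2 = 10 * k + 7 by ring] at p7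
    rw [show 5 * (2 * k + 1) + 3 = 10 * k + 8 by ring] at p8
    rw [show 5 * (2 * k + 1) + 4 = 10 * k + 9 by ring] at p9
    rw [show 5 * (2 * k + 2) = 10 * k + 10 by ring] at p10
    rw [show 2 * (5 * k) + 1 = 10 * k + 1 by ring, show 2 * (5 * k) + 2 = 10 * k + 2 by ring,
      show 2 * (5 * k + 1) + 1 = 10 * k + 3 by ring, show 2 * (5 * k + 1) + 2 = 10 * k + 4 by ring,
      show 2 * (5 * k + 1 + 1) + 1 = 10 * k + 5 by ring, show 2 * (5 * k + 1 + 1) + 2 = 10 * k + 6 by ring,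
      show 2 * (5 * k + 1 + 1 + 1) + 1 = 10 * k + 7 by ring, show 2 * (5 * k + 1 + 1 + 1) + 2 = 10 * k + 8 by ring,
      show 2 * (5 * k + 1 + 1 + 1 + 1) + 1 = 10 * k + 9 by ring,
      show 2 * (5 * k + 1 + 1 + 1 + 1) + 2 = 10 * k + 10 by ring]
    rw [p1, p2, p3, p4, p5, p6, p7, p8, p9, p10]
    simp only [add_assoc, Nat.reduceAdd] at n1 n3 n5 n7 n9 m1
    generalize (1 : ℂ) - (x ^ 5) ^ (10 * k + 1) = w1 at *
    generalize (1 : ℂ) - (x ^ 5) ^ (10 * k + 2) = w2 at *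
    generalize (1 : ℂ) - (x ^ 5) ^ (10 * k + 3) = w3 at *
    generalize (1 : ℂ) - (x ^ 5) ^ (10 * k + 4) = w4 at *
    generalize (1 : ℂ) - (x ^ 5) ^ (10 * k + 5) = w5 at *
    generalize (1 : ℂ) - (x ^ 5) ^ (10 * k + 6) = w6 at *
    generalize (1 : ℂ) - (x ^ 5) ^ (10 * k + 7) = w7 at *
    generalize (1 : ℂ) - (x ^ 5) ^ (10 * k + 8) = w8 at *
    generalize (1 : ℂ) - (x ^ 5) ^ (10 * k + 9) = w9 at *
    generalize (1 : ℂ) - (x ^ 5) ^ (10 * k + 10) = w10 at *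
    generalize (1 : ℂ) - (x ^ 5) ^ (2 * k + 1) = v1 at *
    generalize (1 : ℂ) - (x ^ 5) ^ (2 * k + 2) = v2 at *
    field_simp
    linear_combination (w2 * w4 * w6 * w8 * w10 * v2 ^ 5) * ih

lemma Psi_norm (hz : 1 + z + z ^ 2 + z ^ 3 + z ^ 4 = 0) (hx : ‖x‖ < 1) :
    (∏ j ∈ Finset.range 5, Psi (z ^ j * x)) * Psi (x ^ 25) = Psi (x ^ 5) ^ 6 := by
  have h5 : ‖x ^ 5‖ < 1 := pow_lt hx (by norm_num)
  have h25 : ‖x ^ 25‖ < 1 := pow_lt hx (by norm_num)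
  have t : Tendsto (fun n : ℕ => 5 * n) atTop atTop :=
    Filter.tendsto_id.const_mul_atTop' (by norm_num)
  have l1 : Tendsto (fun k => PP z x (5 * k) * P k (x ^ 25)) atTop
      (𝓝 ((∏ j ∈ Finset.range 5, Psi (z ^ j * x)) * Psi (x ^ 25))) := by
    refine Tendsto.mul ?_ (P_tendsto h25)
    exact tendsto_finsetProd _ fun j _ => (P_tendsto (zx_norm hz hx j)).comp t
  have l2 : Tendsto (fun k => P (5 * k) (x ^ 5) * P k (x ^ 5) ^ 5) atTop
      (𝓝 (Psi (x ^ 5) * Psi (x ^ 5) ^ 5)) :=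
    ((P_tendsto h5).comp t).mul ((P_tendsto h5).pow 5)
  simp_rw [PP_eq hz hx] at l1
  rw [tendsto_nhds_unique l1 l2]
  ring

end norm

lemma cofactor {z : ℂ} (A b c : ℂ) (hz : 1 + z + z ^ 2 + z ^ 3 + z ^ 4 = 0)
    {f0 f1 f2 f3 f4 : ℂ} (e0 : f0 = A + b + c) (e1 : f1 = A + z * b + z ^ 3 * c)
    (e2 : f2 = A + z ^ 2 * b + z * c) (e3 : f3 = A + z ^ 3 * b + z ^ 4 * c)
    (e4 : f4 = A + z ^ 4 * b + z ^ 2 * c) :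
    f1 * f2 * f3 * f4 + z ^ 3 * (f0 * f2 * f3 * f4) + z * (f0 * f1 * f3 * f4)
      + z ^ 4 * (f0 * f1 * f2 * f4) + z ^ 2 * (f0 * f1 * f2 * f3) =
      5 * (A ^ 2 * b ^ 2 - 3 * A * b * c ^ 2 + c ^ 4) := by
  subst e0 e1 e2 e3 e4
  linear_combination ((2)*z^9*A^1*b^2*c^1 + (2)*z^9*A^0*b^3*c^1 + (3)*z^9*A^0*b^2*c^2 + (1)*z^8*A^1*b^3*c^0 + (-2)*z^8*A^1*b^2*c^1 + (3)*z^8*A^1*b^1*c^2 + (1)*z^8*A^0*b^4*c^0 + (4)*z^8*A^0*b^1*c^3 + (2)*z^7*A^2*b^1*c^1 + (4)*z^7*A^1*b^2*c^1 + (3)*z^7*A^1*b^1*c^2 + (2)*z^7*A^0*b^3*c^1 + (3)*z^7*A^0*b^2*c^2 + (2)*z^6*A^2*b^2*c^0 + (-2)*z^6*A^2*b^1*c^1 + (1)*z^6*A^1*b^3*c^0 + (4)*z^6*A^1*b^2*c^1 + (-6)*z^6*A^1*b^1*c^2 + (4)*z^6*A^1*b^0*c^3 + (5)*z^6*A^0*b^0*c^4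 + (4)*z^5*A^2*b^1*c^1 + (3)*z^5*A^2*b^0*c^2 + (2)*z^5*A^1*b^3*c^0 + (2)*z^5*A^1*b^2*c^1 + (12)*z^5*A^1*b^1*c^2 + (-5)*z^5*A^0*b^0*c^4 + (1)*z^4*A^3*b^1*c^0 + (1)*z^4*A^2*b^2*c^0 + (4)*z^4*A^2*b^1*c^1 + (2)*z^4*A^1*b^2*c^1 + (3)*z^4*A^1*b^1*c^2 + (2)*z^3*A^3*b^0*c^1 + (1)*z^3*A^2*b^2*c^0 + (2)*z^3*A^2*b^1*c^1 + (3)*z^3*A^2*b^0*c^2 + (1)*z^2*A^3*b^1*c^0 + (1)*z^2*A^2*b^2*c^0 + (2)*z^2*A^2*b^1*c^1 + (2)*z^1*A^3*b^1*c^0 + (2)*z^1*A^3*b^0*c^1 + (5)*z^1*A^2*b^2*c^0 + (-15)*z^1*A^1*b^1*c^2 + (5)*z^1*A^0*b^0*c^4 + (1)*z^0*A^4*b^0*c^0 + (-5)*z^0*A^2*b^2*c^0 + (15)*z^0*A^1*b^1*c^2 + (-5)*z^0*A^0*b^0*c^4) * hz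

/-- `x ψ(x)^3 ψ(x^5)`. -/
noncomputable def G1 (x : ℂ) : ℂ := x * Psi x ^ 3 * Psi (x ^ 5)

/-- `x^2 ψ(x) ψ(x^5)^3`. -/
noncomputable def G2 (x : ℂ) : ℂ := x ^ 2 * Psi x * Psi (x ^ 5) ^ 3

/-- `x^3 ψ(x^5)^5 / ψ(x)`. -/
noncomputable def Hh (x : ℂ) : ℂ := x ^ 3 * Psi (x ^ 5) ^ 5 / Psi x

section U

variable {z x : ℂ}

lemma zpow5 (hz : 1 + z + z ^ 2 + z ^ 3 + z ^ 4 = 0) (j : ℕ) : (z ^ j * x) ^ 5 = x ^ 5 := by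
  rw [mul_pow, ← pow_mul, mul_comm j 5, pow_mul, z5 hz, one_pow, one_mul]

lemma Psi_z (hz : 1 + z + z ^ 2 + z ^ 3 + z ^ 4 = 0) (hx : ‖x‖ < 1) (j : ℕ) :
    Psi (z ^ j * x) = TA (x ^ 5) + z ^ j * (x * TB (x ^ 5)) +
      z ^ (3 * j) * (x ^ 3 * Psi (x ^ 25)) := by
  rw [Psi_dissect (zx_norm hz hx j), zpow5 hz,
    show (z ^ j * x) ^ 25 = ((z ^ j * x) ^ 5) ^ 5 by ring, zpow5 hz]
  ring

lemma UG2 (hz : 1 + z + z ^ 2 + z ^ 3 + z ^ 4 = 0) (hx : ‖x‖ < 1) :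
    ∑ j ∈ Finset.range 5, G2 (z ^ j * x) = 5 * G1 (x ^ 5) := by
  have h5 := z5 hz
  simp only [G2, G1, zpow5 hz, Psi_z hz hx, Finset.sum_range_succ, Finset.sum_range_zero]
  rw [show (x ^ 5) ^ 5 = x ^ 25 by ring]
  generalize TA (x ^ 5) = A
  generalize TB (x ^ 5) = B
  generalize Psi (x ^ 25) = C
  generalize Psi (x ^ 5) = p
  have r6 : z ^ 6 = z := by linear_combination z * h5
  have r8 : z ^ 8 = z ^ 3 := by linear_combination z ^ 3 * h5
  have r9 : z ^ 9 = z ^ 4 := by linear_combination z ^ 4 * h5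
  have r12 : z ^ 12 = z ^ 2 := by linear_combination (z ^ 7 + z ^ 2) * h5
  norm_num only
  rw [r6, r9, r12]
  grind

lemma UG1 (hz : 1 + z + z ^ 2 + z ^ 3 + z ^ 4 = 0) (hx : ‖x‖ < 1) :
    ∑ j ∈ Finset.range 5, G1 (z ^ j * x) = 5 * (6 * G1 (x ^ 5) - 5 * G2 (x ^ 5)) := by
  have h5 := z5 hz
  have hsq := Psi_sq (y := x ^ 5) (pow_lt hx (by norm_num))
  simp only [G2, G1, zpow5 hz, Psi_z hz hx, Finset.sum_range_succ, Finset.sum_range_zero]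
  rw [show (x ^ 5) ^ 5 = x ^ 25 by ring] at *
  generalize TA (x ^ 5) = A at *
  generalize TB (x ^ 5) = B at *
  generalize Psi (x ^ 25) = C at *
  generalize Psi (x ^ 5) = p at *
  have r6 : z ^ 6 = z := by linear_combination z * h5
  have r9 : z ^ 9 = z ^ 4 := by linear_combination z ^ 4 * h5
  have r12 : z ^ 12 = z ^ 2 := by linear_combination (z ^ 7 + z ^ 2) * h5
  norm_num only
  rw [r6, r9, r12]
  have key : ∀ b c : ℂ, (A + b + c) ^ 3 + z * (A + z * b + z ^ 3 * c) ^ 3 +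
      z ^ 2 * (A + z ^ 2 * b + z * c) ^ 3 + z ^ 3 * (A + z ^ 3 * b + z ^ 4 * c) ^ 3 +
      z ^ 4 * (A + z ^ 4 * b + z ^ 2 * c) ^ 3 = 5 * (6 * A * b * c + c ^ 3) := by
    intro b c
    grind
  have k := key (x * B) (x ^ 3 * C)
  linear_combination x * p * k - 30 * x ^ 5 * p * C * hsq

lemma UH (hz : 1 + z + z ^ 2 + z ^ 3 + z ^ 4 = 0) (hx : ‖x‖ < 1) :
    ∑ j ∈ Finset.range 5, Hh (z ^ j * x) =
      5 * (G1 (x ^ 5) - 5 * G2 (x ^ 5) + 5 * Hh (x ^ 5)) := by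
  have h5 := z5 hz
  have hx5 : ‖x ^ 5‖ < 1 := pow_lt hx (by norm_num)
  have hx25 : ‖x ^ 25‖ < 1 := pow_lt hx (by norm_num)
  have hsq := Psi_sq hx5
  have hn := Psi_norm hz hx
  have q0 := Psi_z hz hx 0
  have q1 := Psi_z hz hx 1
  have q2 := Psi_z hz hx 2
  have q3 := Psi_z hz hx 3
  have q4 := Psi_z hz hx 4
  have m0 := Psi_ne (zx_norm hz hx 0)
  have m1 := Psi_ne (zx_norm hz hx 1)
  have m2 := Psi_ne (zx_norm hz hx 2)
  have m3 := Psi_ne (zx_norm hz hx 3)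
  have m4 := Psi_ne (zx_norm hz hx 4)
  have mp := Psi_ne hx5
  have mC := Psi_ne hx25
  simp only [Hh, G2, G1, zpow5 hz, Finset.sum_range_succ, Finset.sum_range_zero,
    Finset.prod_range_succ, Finset.prod_range_zero] at *
  rw [show (x ^ 5) ^ 5 = x ^ 25 by ring] at *
  have r6 : z ^ 6 = z := by linear_combination z * h5
  have r9 : z ^ 9 = z ^ 4 := by linear_combination z ^ 4 * h5
  have r12 : z ^ 12 = z ^ 2 := by linear_combination (z ^ 7 + z ^ 2) * h5
  generalize TA (x ^ 5) = A at *
  generalize TB (x ^ 5) = B at *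
  generalize Psi (x ^ 25) = C at *
  generalize Psi (x ^ 5) = p at *
  generalize Psi (z ^ 0 * x) = f0 at *
  generalize Psi (z ^ 1 * x) = f1 at *
  generalize Psi (z ^ 2 * x) = f2 at *
  generalize Psi (z ^ 3 * x) = f3 at *
  generalize Psi (z ^ 4 * x) = f4 at *
  norm_num only at q0 q1 q2 q3 q4
  rw [r6] at q2
  rw [r9] at q3
  rw [r12] at q4
  have cof := cofactor A (x * B) (x ^ 3 * C) hz (f0 := f0) (f1 := f1) (f2 := f2) (f3 := f3)
    (f4 := f4) (by rw [q0]; ring) (by rw [q1]; ring) (by rw [q2]) (by rw [q3]) (by rw [q4])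
  have lhs : 0 + (z ^ 0 * x) ^ 3 * p ^ 5 / f0 + (z ^ 1 * x) ^ 3 * p ^ 5 / f1 +
      (z ^ 2 * x) ^ 3 * p ^ 5 / f2 + (z ^ 3 * x) ^ 3 * p ^ 5 / f3 + (z ^ 4 * x) ^ 3 * p ^ 5 / f4 =
      x ^ 3 * p ^ 5 * (f1 * f2 * f3 * f4 + z ^ 3 * (f0 * f2 * f3 * f4) + z * (f0 * f1 * f3 * f4)
      + z ^ 4 * (f0 * f1 * f2 * f4) + z ^ 2 * (f0 * f1 * f2 * f3)) / (f0 * f1 * f2 * f3 * f4) := by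
    simp only [mul_pow, ← pow_mul]
    norm_num only
    rw [r6, r9, r12]
    field_simp
    ring
  rw [lhs, cof]
  have hprod : f0 * f1 * f2 * f3 * f4 = p ^ 6 / C := by
    rw [eq_div_iff mC, ← hn]; ring
  rw [hprod]
  have hD : A * B = p ^ 2 - x ^ 5 * C ^ 2 := by linear_combination -hsq
  have e : x ^ 3 * (A ^ 2 * (x * B) ^ 2 - 3 * A * (x * B) * (x ^ 3 * C) ^ 2 + (x ^ 3 * C) ^ 4) =
      x ^ 5 * p ^ 4 - 5 * x ^ 10 * p ^ 2 * C ^ 2 + 5 * x ^ 15 * C ^ 4 := by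
    have : x ^ 3 * (A ^ 2 * (x * B) ^ 2 - 3 * A * (x * B) * (x ^ 3 * C) ^ 2 + (x ^ 3 * C) ^ 4) =
      x ^ 5 * (A * B) ^ 2 - 3 * x ^ 10 * (A * B) * C ^ 2 + x ^ 15 * C ^ 4 := by ring
    rw [this, hD]; ring
  field_simp
  linear_combination e

lemma U_hasSum (hz : 1 + z + z ^ 2 + z ^ 3 + z ^ 4 = 0) {γ : ℕ → ℂ} {f : ℂ → ℂ}
    (hf : ∀ x : ℂ, ‖x‖ < 1 → HasSum (fun m => γ m * x ^ m) (f x)) (hx : ‖x‖ < 1) :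
    HasSum (fun m => γ (5 * m) * (x ^ 5) ^ m) ((∑ j ∈ Finset.range 5, f (z ^ j * x)) / 5) := by
  have h5 := z5 hz
  have h1 : HasSum (fun m => (∑ j ∈ Finset.range 5, γ m * (z ^ j * x) ^ m) / 5)
      ((∑ j ∈ Finset.range 5, f (z ^ j * x)) / 5) :=
    (hasSum_sum fun j _ => hf _ (zx_norm hz hx j)).div_const 5
  have inj : Function.Injective (fun m : ℕ => 5 * m) := fun a b h => by simpa using h
  have hsupp : ∀ m, m ∉ Set.range (fun m : ℕ => 5 * m) →
      (∑ j ∈ Finset.range 5, γ m * (z ^ j * x) ^ m) / 5 = 0 := by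
    intro m hm
    have hm' : m % 5 ≠ 0 := fun h => hm ⟨m / 5, by simp only; omega⟩
    have zm : z ^ m = z ^ (m % 5) := by
      conv_lhs => rw [← Nat.div_add_mod m 5, pow_add, pow_mul, h5, one_pow, one_mul]
    have hv : 1 + z ^ m + (z ^ m) ^ 2 + (z ^ m) ^ 3 + (z ^ m) ^ 4 = 0 := by
      rw [zm]
      have : m % 5 = 1 ∨ m % 5 = 2 ∨ m % 5 = 3 ∨ m % 5 = 4 := by omega
      rcases this with h | h | h | h <;> rw [h] <;> grind
    have : ∑ j ∈ Finset.range 5, γ m * (z ^ j * x) ^ m =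
        γ m * x ^ m * (1 + z ^ m + (z ^ m) ^ 2 + (z ^ m) ^ 3 + (z ^ m) ^ 4) := by
      simp only [Finset.sum_range_succ, Finset.sum_range_zero]
      ring
    rw [this, hv]; simp
  have h2 := (inj.hasSum_iff hsupp).mpr h1
  refine hs_congr h2 fun m => ?_
  simp only [Function.comp]
  have : ∀ j : ℕ, (z ^ j * x) ^ (5 * m) = (x ^ 5) ^ m := by
    intro j
    rw [pow_mul, zpow5 hz]
  simp only [this]
  simp

end U

lemma exists_root : ∃ z : ℂ, 1 + z + z ^ 2 + z ^ 3 + z ^ 4 = 0 := by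
  have h := (Complex.isPrimitiveRoot_exp 5 (by norm_num)).geom_sum_eq_zero (by norm_num)
  refine ⟨Complex.exp (2 * Real.pi * Complex.I / (5 : ℕ)), ?_⟩
  simpa [Finset.sum_range_succ] using h

lemma exists_fifth {w : ℂ} (hw : ‖w‖ < 1) : ∃ x : ℂ, ‖x‖ < 1 ∧ x ^ 5 = w := by
  obtain ⟨x, hx⟩ := IsAlgClosed.exists_pow_nat_eq w (n := 5) (by norm_num)
  refine ⟨x, ?_, hx⟩
  by_contra h
  rw [not_lt] at h
  have := one_le_pow₀ h (n := 5)
  rw [← norm_pow, hx] at this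
  linarith

lemma hs_congr' {α : Type*} {f g : α → ℂ} {s t : ℂ} (h : HasSum f s) (e : ∀ a, g a = f a)
    (hst : t = s) : HasSum g t := by
  rwa [funext e, hst]

lemma coeff_zero {γ : ℕ → ℂ} (h : ∀ x : ℂ, ‖x‖ < 1 → HasSum (fun m => γ m * x ^ m) 0) (m : ℕ) :
    γ m = 0 := by
  have hp : HasFPowerSeriesOnBall (0 : ℂ → ℂ) (FormalMultilinearSeries.ofScalars ℂ γ) 0
      ((1 / 2 : NNReal) : ENNReal) := by
    refine ⟨?_, by simp, ?_⟩
    · apply FormalMultilinearSeries.le_radius_of_summable_norm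
      have := (h (1 / 2) (by norm_num)).summable.norm
      simpa using this
    · intro y hy
      have hy' : ‖y‖ < 1 := by
        have : ‖y‖ < 1 / 2 := by
          rw [Metric.eball_coe] at hy
          simpa using hy
        linarith
      simpa [FormalMultilinearSeries.ofScalars_apply_eq, mul_comm] using h y hy'
  have h0 := hp.hasFPowerSeriesAt.eq_zero
  have := congrArg (fun p => FormalMultilinearSeries.coeff p m) h0
  have h1 : FormalMultilinearSeries.coeff (0 : FormalMultilinearSeries ℂ ℂ ℂ) m = 0 := rfl
  simp only [FormalMultilinearSeries.coeff_ofScalars] at this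
  exact this.trans h1

lemma recur {γ : ℕ → ℂ} (hf : ∀ x : ℂ, ‖x‖ < 1 → HasSum (fun m => γ m * x ^ m) (Hh x)) (m : ℕ) :
    γ (25 * m) - 6 * γ (5 * m) + 5 * γ m = 0 := by
  obtain ⟨z, hz⟩ := exists_root
  have h1 : ∀ w : ℂ, ‖w‖ < 1 →
      HasSum (fun m => γ (5 * m) * w ^ m) (G1 w - 5 * G2 w + 5 * Hh w) := by
    intro w hw
    obtain ⟨x, hx, rfl⟩ := exists_fifth hw
    have := U_hasSum hz hf hx
    rw [UH hz hx] at this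
    convert this using 1
    ring
  have h2 : ∀ w : ℂ, ‖w‖ < 1 →
      HasSum (fun m => γ (25 * m) * w ^ m) (6 * (G1 w - 5 * G2 w + 5 * Hh w) - 5 * Hh w) := by
    intro w hw
    obtain ⟨x, hx, rfl⟩ := exists_fifth hw
    have := U_hasSum hz h1 hx
    rw [Finset.sum_add_distrib, Finset.sum_sub_distrib, ← Finset.mul_sum, ← Finset.mul_sum,
      UH hz hx, UG1 hz hx, UG2 hz hx] at this
    simp only [← mul_assoc, Nat.reduceMul] at this
    convert this using 1
    ring
  refine coeff_zero (γ := fun m => γ (25 * m) - 6 * γ (5 * m) + 5 * γ m) (fun x hx => ?_) m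
  have := ((h2 x hx).sub ((h1 x hx).mul_left 6)).add ((hf x hx).mul_left 5)
  exact hs_congr' this (fun k => by ring) (by ring)

end Psi5

theorem stmt_11 (b : ℕ → ℤ)
    (hb : ∀ q : ℂ, ‖q‖ < 1 →
      ∑' n : ℕ, (b n : ℂ) * q ^ n = psiNeg (q ^ 5) ^ 5 / psiNeg q) :
    ∀ n : ℕ, ∀ k : ℕ, 2 ≤ k →
      b (5 ^ k * (n + 3) - 3) = ((5 ^ k - 1) / 4 : ℤ) * b (5 * n + 12) - ((5 ^ k - 5) / 4 : ℤ) * b n := by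
  have hsum : ∀ q : ℂ, ‖q‖ < 1 →
      HasSum (fun n : ℕ => (b n : ℂ) * q ^ n) (psiNeg (q ^ 5) ^ 5 / psiNeg q) := by
    intro q hq
    have hne : psiNeg (q ^ 5) ^ 5 / psiNeg q ≠ 0 :=
      div_ne_zero (pow_ne_zero _ (Psi5.psiNeg_ne (Psi5.pow_lt hq (by norm_num))))
        (Psi5.psiNeg_ne hq)
    rw [← hb q hq] at hne ⊢
    refine Summable.hasSum ?_
    by_contra h
    exact hne (tsum_eq_zero_of_not_summable h)
  -- coefficients of `x^3 ψ(x^5)^5 / ψ(x)`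
  let c : ℕ → ℂ := fun m => if m < 3 then 0 else (-1) ^ (m - 3) * (b (m - 3) : ℂ)
  have hc : ∀ x : ℂ, ‖x‖ < 1 → HasSum (fun m => c m * x ^ m) (Psi5.Hh x) := by
    intro x hx
    rw [← hasSum_nat_add_iff' 3]
    have h := (hsum (-x) (by simpa using hx)).mul_left (x ^ 3)
    have h5 : (-x) ^ 5 = -(x ^ 5) := by ring
    refine Psi5.hs_congr' h (fun m => ?_) ?_
    · simp only [c]
      rw [if_neg (by omega), Nat.add_sub_cancel, neg_pow x]
      ring
    · simp [Finset.sum_range_succ, c, Psi5.Hh, Psi5.Psi, h5]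
      ring
  have hrec : ∀ m : ℕ, b (25 * (m + 3) - 3) = 6 * b (5 * (m + 3) - 3) - 5 * b m := by
    intro m
    have h := Psi5.recur hc (m + 3)
    simp only [c] at h
    rw [if_neg (by omega), if_neg (by omega), if_neg (by omega)] at h
    have s1 : (-1 : ℂ) ^ (25 * (m + 3) - 3) = (-1) ^ m := by
      rw [show 25 * (m + 3) - 3 = m + 2 * (12 * m + 36) by omega, pow_add, pow_mul]; simp
    have s2 : (-1 : ℂ) ^ (5 * (m + 3) - 3) = (-1) ^ m := by
      rw [show 5 * (m + 3) - 3 = m + 2 * (2 * m + 6) by omega, pow_add, pow_mul]; simp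
    rw [s1, s2, Nat.add_sub_cancel] at h
    have h' : (-1 : ℂ) ^ m * ((b (25 * (m + 3) - 3) : ℂ) - 6 * b (5 * (m + 3) - 3) + 5 * b m) = 0 := by
      linear_combination h
    have h'' := (mul_eq_zero.mp h').resolve_left (pow_ne_zero _ (by norm_num))
    have : b (25 * (m + 3) - 3) - 6 * b (5 * (m + 3) - 3) + 5 * b m = 0 := by exact_mod_cast h''
    linarith
  intro n k _
  have step : ∀ j : ℕ, b (5 ^ (j + 2) * (n + 3) - 3) =
      6 * b (5 ^ (j + 1) * (n + 3) - 3) - 5 * b (5 ^ j * (n + 3) - 3) := by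
    intro j
    have h1 : 1 ≤ 5 ^ j := Nat.one_le_pow _ _ (by norm_num)
    have h := hrec (5 ^ j * (n + 3) - 3)
    have e : 5 ^ j * (n + 3) - 3 + 3 = 5 ^ j * (n + 3) := Nat.sub_add_cancel (by nlinarith)
    rw [e] at h
    rw [show 5 ^ (j + 2) * (n + 3) = 25 * (5 ^ j * (n + 3)) by ring,
      show 5 ^ (j + 1) * (n + 3) = 5 * (5 ^ j * (n + 3)) by ring]
    exact h
  have main : ∀ j : ℕ,
      4 * b (5 ^ j * (n + 3) - 3) = (5 ^ j - 1) * b (5 * n + 12) - (5 ^ j - 5) * b n ∧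
      4 * b (5 ^ (j + 1) * (n + 3) - 3) =
        (5 ^ (j + 1) - 1) * b (5 * n + 12) - (5 ^ (j + 1) - 5) * b n := by
    intro j
    induction j with
    | zero =>
      constructor
      · simp
      · rw [show 5 ^ (0 + 1) * (n + 3) - 3 = 5 * n + 12 by omega]; ring
    | succ j ih =>
      refine ⟨ih.2, ?_⟩
      rw [show j + 1 + 1 = j + 2 by ring, step j]
      have a := ih.1
      have b' := ih.2
      linear_combination 6 * b' - 5 * a
  have hk := (main k).1
  obtain ⟨t, ht⟩ : (4 : ℤ) ∣ 5 ^ k - 1 := by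
    have := sub_dvd_pow_sub_pow (5 : ℤ) 1 k
    simpa using this
  have d1 : ((5 : ℤ) ^ k - 1) / 4 = t := by omega
  have d2 : ((5 : ℤ) ^ k - 5) / 4 = t - 1 := by omega
  rw [d1, d2]
  have e5 : (5 : ℤ) ^ k = 4 * t + 1 := by linarith
  rw [e5] at hk
  linarith
end

section
/- For every positive integer n, b̅₅(4n+1) = c₅(n) − 2·b̅₅(2n−1). -/
open scoped BigOperators

lemma qpoch_summable (a : ℂ) {q : ℂ} (hq : ‖q‖ < 1) : Summable fun k : ℕ => ‖-(a * q ^ k)‖ := by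
  simpa using (summable_geometric_of_lt_one (norm_nonneg _) hq).mul_left ‖a‖

lemma qpoch_mult (a : ℂ) {q : ℂ} (hq : ‖q‖ < 1) : Multipliable fun k : ℕ => (1 - a * q ^ k) := by
  simpa [sub_eq_add_neg] using multipliable_one_add_of_summable (qpoch_summable a hq)

lemma fin_nat_equiv (d : ℕ) (hd : d ≠ 0) :
    ∃ e : Fin d × ℕ ≃ ℕ, ∀ p, e p = p.1 + d * p.2 := by
  have : NeZero d := ⟨hd⟩
  refine ⟨(Equiv.prodComm _ _).trans (Nat.divModEquiv d).symm, fun p => ?_⟩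
  simp [Nat.divModEquiv]; ring

lemma qpoch_split (d : ℕ) (hd : d ≠ 0) (a : ℂ) {q : ℂ} (hq : ‖q‖ < 1) :
    qpoch a q = ∏ j : Fin d, qpoch (a * q ^ (j : ℕ)) (q ^ d) := by
  have hqd : ‖q ^ d‖ < 1 := by
    rw [norm_pow]; exact pow_lt_one₀ (norm_nonneg _) hq hd
  obtain ⟨e, he⟩ := fin_nat_equiv d hd
  have hm := qpoch_mult a hq
  have he' : (fun p : Fin d × ℕ => 1 - a * q ^ (e p)) =
      fun p => 1 - (a * q ^ (p.1 : ℕ)) * (q ^ d) ^ p.2 := by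
    refine funext fun p => ?_
    rw [he p, pow_add, pow_mul]; ring
  have hm' : Multipliable fun p : Fin d × ℕ => 1 - a * q ^ (e p) := (e.multipliable_iff (f := fun k : ℕ => 1 - a * q ^ k)).2 hm
  have h1 : ∏' p : Fin d × ℕ, (1 - a * q ^ (e p)) = qpoch a q :=
    e.tprod_eq (fun k => 1 - a * q ^ k)
  rw [he'] at hm' h1
  have h0 : ∀ b : Fin d, Multipliable fun c : ℕ => (1 - (a * q ^ ((b, c).1 : ℕ)) * (q ^ d) ^ (b, c).2) :=
    fun b => qpoch_mult (a * q ^ (b : ℕ)) hqd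
  have h2 := hm'.tprod_prod' h0
  rw [h1, tprod_fintype] at h2
  rw [h2]
  simp only [qpoch]

lemma qpoch_pm (a : ℂ) {q : ℂ} (hq : ‖q‖ < 1) : qpoch a q * qpoch (-a) q = qpoch (a ^ 2) (q ^ 2) := by
  unfold qpoch
  rw [← (qpoch_mult a hq).tprod_mul (qpoch_mult (-a) hq)]
  congr 1; ext k; ring

lemma qpoch_ne (a : ℂ) {q : ℂ} (hq : ‖q‖ < 1) (ha : ‖a‖ < 1) : qpoch a q ≠ 0 := by
  unfold qpoch
  have := tprod_one_add_ne_zero_of_summable (f := fun k : ℕ => -(a * q ^ k)) ?_ (qpoch_summable a hq)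
  · simpa [sub_eq_add_neg] using this
  · intro k h
    have h1 : a * q ^ k = 1 := by linear_combination -h
    have h2 : ‖a * q ^ k‖ < 1 := by
      rw [norm_mul, norm_pow]
      calc ‖a‖ * ‖q‖ ^ k ≤ ‖a‖ * 1 := by
            gcongr; exact pow_le_one₀ (norm_nonneg _) hq.le
        _ < 1 := by simpa
    rw [h1] at h2; simp at h2

/-- Euler function. -/
noncomputable def eu (q : ℂ) : ℂ := qpoch q q

lemma npow_lt {q : ℂ} (hq : ‖q‖ < 1) {k : ℕ} (hk : k ≠ 0) : ‖q ^ k‖ < 1 := by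
  rw [norm_pow]; exact pow_lt_one₀ (norm_nonneg _) hq hk

lemma eu_ne {q : ℂ} (hq : ‖q‖ < 1) : eu q ≠ 0 := qpoch_ne q hq hq

lemma eu_split {q : ℂ} (hq : ‖q‖ < 1) : eu q = qpoch q (q ^ 2) * eu (q ^ 2) := by
  unfold eu
  conv_lhs => rw [qpoch_split 2 (by norm_num) q hq]
  simp [Fin.prod_univ_two, pow_two]

/-- `(-q;q²) f₁ f₄ = f₂²` -/
lemma qpoch_odd {q : ℂ} (hq : ‖q‖ < 1) :
    qpoch (-q) (q ^ 2) = eu (q ^ 2) ^ 2 / (eu q * eu (q ^ 4)) := by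
  have h2 := npow_lt hq (k := 2) (by norm_num)
  have h4 := npow_lt hq (k := 4) (by norm_num)
  rw [eq_div_iff (mul_ne_zero (eu_ne hq) (eu_ne h4))]
  have e1 := eu_split hq
  have e2 := eu_split h2
  have e3 := qpoch_pm q h2
  rw [← pow_mul] at e2 e3
  norm_num at e2 e3
  have : qpoch (q^2) (q^4) * eu (q ^ 4) = eu (q^2) := e2.symm
  calc _ = (qpoch q (q^2) * qpoch (-q) (q^2)) * eu (q^2) * eu (q^4) := by rw [e1]; ring
    _ = _ := by rw [e3, ← this]; ring

/-- `(-q;q) = f₂/f₁` -/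
lemma qpoch_all {q : ℂ} (hq : ‖q‖ < 1) : qpoch (-q) q = eu (q ^ 2) / eu q := by
  rw [eq_div_iff (eu_ne hq)]
  have := qpoch_pm q hq
  unfold eu; rw [← this]; ring

lemma eu_neg {q : ℂ} (hq : ‖q‖ < 1) : eu (-q) = eu (q ^ 2) ^ 3 / (eu q * eu (q ^ 4)) := by
  have e1 := eu_split (q := -q) (by simpa using hq)
  rw [neg_sq] at e1
  rw [e1, qpoch_odd hq]; ring

lemma qpoch_neg_one {q : ℂ} (hq : ‖q‖ < 1) : qpoch (-1) q = 2 * qpoch (-q) q := by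
  have h := qpoch_mult (-q) hq
  have he : (fun k : ℕ => 1 - (-q) * q ^ k) = (fun k : ℕ => 1 - (-1) * q ^ (k + 1)) := by
    funext k; ring
  have h2 := h
  rw [he] at h2
  have h3 := tprod_eq_zero_mul' (f := fun k : ℕ => 1 - (-1) * q ^ k) h2
  have h4 : qpoch (-q) q = ∏' k : ℕ, (1 - (-1) * q ^ (k + 1)) := by
    unfold qpoch; rw [he]
  rw [h4]
  have h5 : (1 - (-1) * q ^ 0 : ℂ) = 2 := by norm_num
  rw [h5] at h3
  exact h3

lemma eu_cont : ContinuousAt eu 0 := by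
  have h := ModularForm.differentiableOn_tprod_one_sub_pow.continuousOn.continuousAt
    (Metric.isOpen_ball.mem_nhds (Metric.mem_ball_self (x := (0:ℂ)) one_pos))
  convert h using 1
  ext q; unfold eu qpoch
  congr 1; ext k; ring

lemma eu_zero : eu 0 = 1 := by
  unfold eu qpoch; simp

open Filter Topology Finset in
lemma qpoch_tendsto (a : ℂ) {q : ℂ} (hq : ‖q‖ < 1) :
    Tendsto (fun N => ∏ k ∈ range N, (1 - a * q ^ k)) atTop (𝓝 (qpoch a q)) :=
  (qpoch_mult a hq).hasProd.tendsto_prod_nat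

/-- Gaussian binomials. -/
noncomputable def gb (Q : ℂ) : ℕ → ℕ → ℂ
  | _, 0 => 1
  | 0, _ + 1 => 0
  | m + 1, j + 1 => gb Q m j + Q ^ (j + 1) * gb Q m (j + 1)

lemma gb_zero (Q : ℂ) (m : ℕ) : gb Q m 0 = 1 := by cases m <;> simp [gb]

lemma gb_gt (Q : ℂ) (m : ℕ) : ∀ j, m < j → gb Q m j = 0 := by
  induction m with
  | zero => intro j hj; obtain ⟨i, rfl⟩ := Nat.exists_eq_succ_of_ne_zero (by omega : j ≠ 0); simp [gb]
  | succ m ih =>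
    intro j hj
    obtain ⟨i, rfl⟩ := Nat.exists_eq_succ_of_ne_zero (by omega : j ≠ 0)
    simp [gb, ih i (by omega), ih (i+1) (by omega)]

/-- finite products `(Q;Q)_m` -/
noncomputable def fp (Q : ℂ) (m : ℕ) : ℂ := ∏ k ∈ Finset.range m, (1 - Q * Q ^ k)

lemma fp_succ (Q : ℂ) (m : ℕ) : fp Q (m + 1) = fp Q m * (1 - Q * Q ^ m) := by
  simp [fp, Finset.prod_range_succ]

lemma gb_closed (Q : ℂ) : ∀ s i j : ℕ, i + j = s → gb Q (j + i) j * (fp Q j * fp Q i) = fp Q (j + i) := by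
  intro s
  induction s with
  | zero => intro i j h; obtain ⟨rfl, rfl⟩ : i = 0 ∧ j = 0 := by omega
            simp [gb, fp]
  | succ s ih =>
    intro i j h
    rcases j with _ | j
    · simp [gb_zero, fp]
    rcases i with _ | i
    · have := ih 0 j (by omega)
      simp only [add_zero, gb, gb_gt Q j (j+1) (by omega), mul_zero] at this ⊢
      rw [fp_succ]; linear_combination (1 - Q * Q ^ j) * this
    · have h1 := ih (i+1) j (by omega)
      have h2 := ih i (j+1) (by omega)
      have e1 : j + 1 + (i + 1) = (j + (i + 1)) + 1 := by ring
      have e2 : j + 1 + i = j + (i + 1) := by ring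
      rw [e2] at h2
      rw [e1, gb, fp_succ Q (j + (i+1))]
      rw [fp_succ Q j] at *
      rw [fp_succ Q i] at *
      have e3 : Q * Q ^ (j + (i+1)) = Q * Q ^ j * (Q * Q ^ i) := by ring
      rw [e3]
      linear_combination (1 - Q * Q ^ j) * h1 + Q ^ (j+1) * (1 - Q * Q ^ i) * h2

lemma qbinom (Q : ℂ) (m : ℕ) : ∀ x : ℂ, ∏ k ∈ Finset.range m, (1 + x * Q ^ k) =
    ∑ j ∈ Finset.range (m + 1), Q ^ (j.choose 2) * gb Q m j * x ^ j := by
  induction m with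
  | zero => intro x; simp [gb]
  | succ m ih =>
    intro x
    rw [Finset.prod_range_succ']
    have h : ∀ k, x * Q ^ (k + 1) = (x * Q) * Q ^ k := fun k => by ring
    simp_rw [h]
    rw [ih (x * Q), Finset.sum_range_succ' _ (m+1)]
    simp only [gb]
    have hc : ∀ j : ℕ, (j+1).choose 2 = j + j.choose 2 := fun j => by
      rw [Nat.choose_succ_succ' j 1, Nat.choose_one_right]
    have h1 : ∑ j ∈ Finset.range (m + 1), Q ^ ((j+1).choose 2) * (gb Q m j + Q ^ (j + 1) * gb Q m (j + 1)) * x ^ (j+1)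
      = x * (∑ j ∈ Finset.range (m + 1), Q ^ (j.choose 2) * gb Q m j * (x*Q) ^ j)
       + ∑ j ∈ Finset.range (m + 1), Q ^ ((j+1).choose 2) * gb Q m (j+1) * (x*Q) ^ (j+1) := by
      rw [Finset.mul_sum, ← Finset.sum_add_distrib]
      refine Finset.sum_congr rfl fun j _ => ?_
      rw [hc j]; ring
    rw [h1]
    have h2 := Finset.sum_range_succ' (fun j => Q ^ (j.choose 2) * gb Q m j * (x*Q) ^ j) (m+1)
    rw [Finset.sum_range_succ, gb_gt Q m (m+1) (by omega)] at h2
    simp only [gb_zero] at h2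
    norm_num at h2 ⊢
    linear_combination h2

lemma prod_flip (a Q : ℂ) (ha : a ≠ 0) (hQ : Q ≠ 0) (N : ℕ) :
    (∏ k ∈ Finset.range N, (1 + a * (Q ^ N)⁻¹ * Q ^ k)) * Q ^ ((N+1).choose 2) =
      a ^ N * ∏ k ∈ Finset.range N, (1 - (-(Q / a)) * Q ^ k) := by
  induction N with
  | zero => simp
  | succ N ih =>
    rw [Finset.prod_range_succ', Finset.prod_range_succ _ N]
    have h : ∀ k, a * (Q ^ (N+1))⁻¹ * Q ^ (k+1) = a * (Q ^ N)⁻¹ * Q ^ k := fun k => by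
      field_simp; ring
    simp_rw [h]
    have hc : (N+1+1).choose 2 = (N + 1) + (N+1).choose 2 := by
      rw [Nat.choose_succ_succ' (N+1) 1, Nat.choose_one_right]
    rw [hc]
    have e1 : (1 + a * (Q ^ (N+1))⁻¹ * Q ^ 0) * Q ^ (N+1) = a * (1 - (-(Q / a)) * Q ^ N) := by
      field_simp; ring
    calc _ = ((∏ k ∈ Finset.range N, (1 + a * (Q ^ N)⁻¹ * Q ^ k)) * Q ^ ((N+1).choose 2)) *
            ((1 + a * (Q ^ (N+1))⁻¹ * Q ^ 0) * Q ^ (N+1)) := by ring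
      _ = _ := by rw [ih, e1]; ring

lemma choose_cast (j : ℕ) : ((2 * j.choose 2 : ℕ) : ℤ) = j * (j - 1) := by
  induction j with
  | zero => simp
  | succ j ih =>
    rw [Nat.choose_succ_succ' j 1, Nat.choose_one_right, mul_add]
    push_cast at ih ⊢
    rw [ih]; ring

/-- the theta term -/
noncomputable def tt (a s : ℂ) (n : ℤ) : ℂ := a ^ n * s ^ (n * (n - 1))

/-- coefficient in finite JTP -/
noncomputable def cc (Q : ℂ) (N : ℕ) (n : ℤ) : ℂ := if -(N:ℤ) ≤ n then gb Q (2 * N) (N + n).toNat else 0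

lemma finite_jtp (a s : ℂ) (ha : a ≠ 0) (hs : s ≠ 0) (N : ℕ) :
    (∏ k ∈ Finset.range N, (1 - (-a) * (s^2) ^ k)) * (∏ k ∈ Finset.range N, (1 - (-(s^2 / a)) * (s^2) ^ k))
      = ∑' n : ℤ, cc (s^2) N n * tt a s n := by
  have hQ : s^2 ≠ 0 := pow_ne_zero _ hs
  let emb : ℕ ↪ ℤ := ⟨fun j => (j:ℤ) - N, fun x y h => by simpa using h⟩
  rw [tsum_eq_sum (s := (Finset.range (2*N+1)).map emb)]
  · rw [Finset.sum_map]
    have h1 := qbinom (s^2) (2*N) (a * ((s^2)^N)⁻¹)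
    rw [two_mul, Finset.prod_range_add, ← two_mul] at h1
    have h2 := prod_flip a (s^2) ha hQ N
    have h3 : ∀ k, a * ((s^2)^N)⁻¹ * (s^2) ^ (N + k) = a * (s^2)^k := fun k => by
      field_simp; ring
    simp_rw [h3] at h1
    have hx : ((s^2) ^ ((N+1).choose 2)) ≠ 0 := pow_ne_zero _ hQ
    have ha' : a ^ N ≠ 0 := pow_ne_zero _ ha
    have h4 : ∀ j ∈ Finset.range (2*N+1), cc (s^2) N (emb j) * tt a s (emb j) =
       ((s^2) ^ ((N+1).choose 2) / a ^ N) *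
        ((s^2) ^ (j.choose 2) * gb (s^2) (2*N) j * (a * ((s^2)^N)⁻¹) ^ j) := by
      intro j _
      have : cc (s^2) N (emb j) = gb (s^2) (2*N) j := by
        show cc (s^2) N ((j:ℤ) - N) = _
        simp [cc]
      rw [this, tt]
      have e1 : a ^ (emb j) = a ^ j / a ^ N := by
        show a ^ ((j:ℤ) - N) = _
        rw [zpow_sub₀ ha, zpow_natCast, zpow_natCast]
      have e2 : s ^ (emb j * (emb j - 1)) = (s^2) ^ ((N+1).choose 2) * (s^2) ^ (j.choose 2) * (((s^2)^N)⁻¹)^j := by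
        rw [← pow_mul, ← pow_mul, ← pow_mul, inv_pow, ← pow_mul]
        rw [← zpow_natCast, ← zpow_natCast, ← zpow_natCast, ← zpow_neg, ← zpow_add₀ hs, ← zpow_add₀ hs]
        congr 1
        rw [choose_cast, choose_cast]
        show ((j:ℤ) - N) * ((j:ℤ) - N - 1) = _
        push_cast; ring
      rw [e1, e2, mul_pow]; ring
    rw [Finset.sum_congr rfl h4, ← Finset.mul_sum, ← h1]
    have h5 : ∀ k, 1 - -a * (s^2)^k = 1 + a * (s^2)^k := fun k => by ring
    simp_rw [h5]
    have h2' : (∏ k ∈ Finset.range N, (1 - -(s^2 / a) * (s^2) ^ k)) = (∏ k ∈ Finset.range N, (1 + a * ((s^2) ^ N)⁻¹ * (s^2) ^ k)) * (s^2) ^ ((N+1).choose 2) / a ^ N := by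
      rw [h2, mul_div_cancel_left₀ _ ha']
    rw [h2']; ring
  · intro n hn
    have : cc (s^2) N n = 0 := by
      unfold cc
      split_ifs with h
      · apply gb_gt
        by_contra hcon
        apply hn
        rw [Finset.mem_map]
        exact ⟨((N:ℤ) + n).toNat, by simp; omega, by show (((N:ℤ)+n).toNat : ℤ) - N = n; omega⟩
      · rfl
    rw [this, zero_mul]

open Filter Topology

lemma summ_aux (u : ℕ → ℂ) (b s : ℂ) (hs : ‖s‖ < 1) (hu0 : ∀ n, u n ≠ 0)
    (hu : ∀ m, u (m + 1) = u m * (b * (s ^ 2) ^ m)) : Summable u := by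
  apply summable_of_ratio_test_tendsto_lt_one (l := 0) one_pos (Eventually.of_forall hu0)
  have h : ∀ n, ‖u (n+1)‖ / ‖u n‖ = ‖b‖ * (‖s‖^2) ^ n := fun n => by
    rw [hu n, norm_mul, mul_div_cancel_left₀ _ (norm_ne_zero_iff.2 (hu0 n))]
    simp
  simp_rw [h]
  have : Tendsto (fun n : ℕ => (‖s‖^2) ^ n) atTop (𝓝 0) :=
    tendsto_pow_atTop_nhds_zero_of_lt_one (by positivity) (pow_lt_one₀ (norm_nonneg _) hs (by norm_num))
  simpa using this.const_mul ‖b‖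

lemma tt_summable (a s : ℂ) (ha : a ≠ 0) (hs : s ≠ 0) (h1 : ‖s‖ < 1) : Summable (tt a s) := by
  apply Summable.of_nat_of_neg
  · refine summ_aux _ a s h1 (fun n => mul_ne_zero (zpow_ne_zero _ ha) (zpow_ne_zero _ hs)) fun m => ?_
    have e : ((m+1:ℕ):ℤ) * (((m+1:ℕ):ℤ) - 1) = (m:ℤ) * (m - 1) + ((2 * m : ℕ) : ℤ) := by push_cast; ring
    unfold tt
    rw [e, zpow_add₀ hs, zpow_natCast, zpow_natCast, zpow_natCast, pow_mul, pow_succ]; ring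
  · refine summ_aux _ (s ^ 2 / a) s h1 (fun n => mul_ne_zero (zpow_ne_zero _ ha) (zpow_ne_zero _ hs)) fun m => ?_
    have e : (-((m+1:ℕ):ℤ)) * ((-((m+1:ℕ):ℤ)) - 1) = (-(m:ℤ)) * (-(m:ℤ) - 1) + ((2 * m + 2 : ℕ) : ℤ) := by
      push_cast; ring
    unfold tt
    rw [e, zpow_add₀ hs, zpow_natCast, zpow_neg, zpow_neg, zpow_natCast, zpow_natCast]
    generalize s ^ (-(m:ℤ) * (-(m:ℤ) - 1)) = w
    rw [← pow_mul, pow_succ, mul_inv, pow_add s (2*m) 2]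
    ring

lemma fp_tendsto {Q : ℂ} (hQ : ‖Q‖ < 1) : Tendsto (fp Q) atTop (𝓝 (eu Q)) := qpoch_tendsto Q hQ

lemma fp_ne {Q : ℂ} (hQ : ‖Q‖ < 1) (m : ℕ) : fp Q m ≠ 0 := by
  unfold fp
  rw [Finset.prod_ne_zero_iff]
  intro k _ h
  have h1 : Q ^ (k+1) = 1 := by linear_combination -h
  have h2 := npow_lt hQ (k := k+1) (by omega)
  rw [h1] at h2; simp at h2

lemma cc_eq {Q : ℂ} (hQ : ‖Q‖ < 1) (N : ℕ) (n : ℤ) (h1 : -(N:ℤ) ≤ n) (h2 : n ≤ N) :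
    cc Q N n = fp Q (2 * N) / (fp Q (N + n).toNat * fp Q (N - n).toNat) := by
  unfold cc
  rw [if_pos h1, eq_div_iff (mul_ne_zero (fp_ne hQ _) (fp_ne hQ _))]
  have := gb_closed Q _ (N - n).toNat (N + n).toNat rfl
  have e : (N + n).toNat + (N - n).toNat = 2 * N := by omega
  rwa [e] at this

lemma cc_bound {Q : ℂ} (hQ : ‖Q‖ < 1) : ∃ K : ℝ, ∀ N n, ‖cc Q N n‖ ≤ K := by
  have ht := (fp_tendsto hQ).norm
  have ht2 := ((fp_tendsto hQ).inv₀ (eu_ne hQ)).norm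
  obtain ⟨K1, hK1⟩ := ht.bddAbove_range
  obtain ⟨K2, hK2⟩ := ht2.bddAbove_range
  have b1 : ∀ m, ‖fp Q m‖ ≤ K1 := fun m => hK1 ⟨m, rfl⟩
  have b2 : ∀ m, ‖(fp Q m)⁻¹‖ ≤ K2 := fun m => hK2 ⟨m, rfl⟩
  have p1 : 0 ≤ K1 := (norm_nonneg _).trans (b1 0)
  have p2 : 0 ≤ K2 := (norm_nonneg _).trans (b2 0)
  refine ⟨K1 * (K2 * K2), fun N n => ?_⟩
  by_cases h1 : -(N:ℤ) ≤ n
  · by_cases h2 : n ≤ N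
    · rw [cc_eq hQ N n h1 h2, div_eq_mul_inv, mul_inv, norm_mul, norm_mul]
      exact mul_le_mul (b1 _) (mul_le_mul (b2 _) (b2 _) (norm_nonneg _) p2) (by positivity) p1
    · have : cc Q N n = 0 := by
        unfold cc; rw [if_pos h1]; apply gb_gt; omega
      rw [this, norm_zero]; positivity
  · have : cc Q N n = 0 := by
      unfold cc; rw [if_neg h1]
    rw [this, norm_zero]; positivity

lemma cc_tendsto {Q : ℂ} (hQ : ‖Q‖ < 1) (n : ℤ) : Tendsto (fun N => cc Q N n) atTop (𝓝 (eu Q)⁻¹) := by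
  have ht := fp_tendsto hQ
  have t1 : Tendsto (fun N : ℕ => 2 * N) atTop atTop := tendsto_id.const_mul_atTop' (by norm_num)
  have t2 : Tendsto (fun N : ℕ => ((N:ℤ) + n).toNat) atTop atTop := by
    rw [tendsto_atTop]; intro b
    filter_upwards [eventually_ge_atTop (b + n.natAbs)] with N hN
    omega
  have t3 : Tendsto (fun N : ℕ => ((N:ℤ) - n).toNat) atTop atTop := by
    rw [tendsto_atTop]; intro b
    filter_upwards [eventually_ge_atTop (b + n.natAbs)] with N hN
    omega
  have := (ht.comp t1).div ((ht.comp t2).mul (ht.comp t3)) (mul_ne_zero (eu_ne hQ) (eu_ne hQ))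
  have e : eu Q / (eu Q * eu Q) = (eu Q)⁻¹ := by
    have := eu_ne hQ; field_simp
  rw [e] at this
  refine this.congr' ?_
  filter_upwards [eventually_ge_atTop n.natAbs] with N hN
  rw [cc_eq hQ N n (by omega) (by omega)]; rfl

/-- Jacobi triple product -/
theorem jtp (a s : ℂ) (ha : a ≠ 0) (hs : s ≠ 0) (h1 : ‖s‖ < 1) :
    ∑' n : ℤ, tt a s n = qpoch (-a) (s^2) * qpoch (-(s^2 / a)) (s^2) * eu (s^2) := by
  have hQ : ‖s^2‖ < 1 := npow_lt h1 (by norm_num)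
  obtain ⟨K, hK⟩ := cc_bound hQ
  have hsum := tt_summable a s ha hs h1
  have T1 := tendsto_tsum_of_dominated_convergence (𝓕 := atTop)
    (f := fun N n => cc (s^2) N n * tt a s n) (g := fun n => (eu (s^2))⁻¹ * tt a s n)
    (bound := fun n => K * ‖tt a s n‖) (hsum.norm.mul_left K)
    (fun n => (cc_tendsto hQ n).mul_const _)
    (Eventually.of_forall fun N n => by
      rw [norm_mul]; exact mul_le_mul_of_nonneg_right (hK N n) (norm_nonneg _))
  have T2 := (qpoch_tendsto (-a) hQ).mul (qpoch_tendsto (-(s^2/a)) hQ)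
  simp_rw [finite_jtp a s ha hs] at T2
  have := tendsto_nhds_unique T2 T1
  rw [this, tsum_mul_left]
  have := eu_ne hQ
  field_simp

/-- general theta series -/
noncomputable def th (q : ℂ) (α : ℕ) (β : ℤ) : ℂ := ∑' n : ℤ, q ^ ((α:ℤ) * n ^ 2 + β * n)

lemma th_term (q : ℂ) (hq : q ≠ 0) (α : ℕ) (β : ℤ) (n : ℤ) :
    q ^ ((α:ℤ) * n ^ 2 + β * n) = tt (q ^ ((α:ℤ) + β)) (q ^ α) n := by
  unfold tt
  rw [← zpow_natCast q α, ← zpow_mul, ← zpow_mul, ← zpow_add₀ hq]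
  congr 1; ring

lemma th_summable {q : ℂ} (hq : q ≠ 0) (h1 : ‖q‖ < 1) (α : ℕ) (hα : α ≠ 0) (β : ℤ) :
    Summable fun n : ℤ => q ^ ((α:ℤ) * n ^ 2 + β * n) := by
  simp_rw [th_term q hq]
  exact tt_summable _ _ (zpow_ne_zero _ hq) (pow_ne_zero _ hq) (npow_lt h1 hα)

lemma th_prod {q : ℂ} (hq : q ≠ 0) (h1 : ‖q‖ < 1) (α i j : ℕ) (β : ℤ) (hα : α ≠ 0) (hi : (i:ℤ) = α + β)
    (hj : (j:ℤ) = α - β) :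
    th q α β = qpoch (-q ^ i) (q ^ (2 * α)) * qpoch (-q ^ j) (q ^ (2 * α)) * eu (q ^ (2 * α)) := by
  unfold th
  simp_rw [th_term q hq]
  rw [jtp _ _ (zpow_ne_zero _ hq) (pow_ne_zero _ hq) (npow_lt h1 hα)]
  rw [← hi, zpow_natCast, ← pow_mul, mul_comm α 2]
  have : q ^ (2 * α) / q ^ i = q ^ j := by
    rw [div_eq_iff (pow_ne_zero _ hq), ← pow_add]; congr 1; omega
  rw [this]

lemma th_neg (q : ℂ) (α : ℕ) (β : ℤ) : th q α (-β) = th q α β := by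
  unfold th
  rw [← (Equiv.neg ℤ).tsum_eq]
  congr 1; ext n
  congr 1; simp

lemma th_pow (q : ℂ) (k α : ℕ) (β : ℤ) : th (q ^ k) α β = th q (k * α) (k * β) := by
  unfold th
  congr 1; ext n
  rw [← zpow_natCast, ← zpow_mul]; congr 1; push_cast; ring

lemma th_mul {q : ℂ} (hq : q ≠ 0) (h1 : ‖q‖ < 1) (α α' : ℕ) (hα : α ≠ 0) (hα' : α' ≠ 0) (β β' : ℤ) :
    th q α β * th q α' β' =
      ∑' p : ℤ × ℤ, q ^ (((α:ℤ) * p.1 ^ 2 + β * p.1) + ((α':ℤ) * p.2 ^ 2 + β' * p.2)) := by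
  unfold th
  rw [tsum_mul_tsum_of_summable_norm (th_summable hq h1 α hα β).norm (th_summable hq h1 α' hα' β').norm]
  congr 1; ext p
  rw [zpow_add₀ hq (_ + _)]

lemma th_mul_summable {q : ℂ} (hq : q ≠ 0) (h1 : ‖q‖ < 1) (α α' : ℕ) (hα : α ≠ 0) (hα' : α' ≠ 0) (β β' : ℤ) :
    Summable fun p : ℤ × ℤ => q ^ (((α:ℤ) * p.1 ^ 2 + β * p.1) + ((α':ℤ) * p.2 ^ 2 + β' * p.2)) := by
  have := summable_mul_of_summable_norm (th_summable hq h1 α hα β).norm (th_summable hq h1 α' hα' β').norm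
  refine this.congr fun p => ?_
  rw [zpow_add₀ hq (_ + _)]

lemma dis2 (f : ℤ × ℤ → ℂ) (hf : Summable f) :
    ∑' p, f p = (∑' w : ℤ × ℤ, f (w.1 + w.2, w.1 - w.2)) + ∑' w : ℤ × ℤ, f (w.1 + w.2 + 1, w.1 - w.2) := by
  have hb : Function.Bijective (fun r : Fin 2 × (ℤ × ℤ) =>
      ((r.2.1 + r.2.2 + (r.1 : ℕ), r.2.1 - r.2.2) : ℤ × ℤ)) := by
    constructor
    · rintro ⟨r, u, v⟩ ⟨r', u', v'⟩ h
      simp only [Prod.mk.injEq] at h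
      have h1 := r.2; have h2 := r'.2
      have : (r:ℕ) = r' := by omega
      have : r = r' := Fin.ext this
      subst this
      simp only [Prod.mk.injEq, true_and]; omega
    · rintro ⟨x, y⟩
      refine ⟨(⟨((x - y) % 2).toNat, by omega⟩, (x + y) / 2, (x - y) / 2), ?_⟩
      simp only [Prod.mk.injEq]; omega
  have := (Equiv.ofBijective _ hb).tsum_eq f
  rw [← this]
  have hs : Summable fun r => f (Equiv.ofBijective _ hb r) := (Equiv.summable_iff _).2 hf
  rw [hs.tsum_prod, tsum_fintype, Fin.sum_univ_two]
  simp

lemma dis5 (f : ℤ × ℤ → ℂ) (hf : Summable f) (a b : Fin 5 → ℤ)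
    (h : ∀ i j : Fin 5, (5:ℤ) ∣ (a i - 2 * b i) - (a j - 2 * b j) → i = j)
    (h' : ∀ x : ℤ, ∃ i, (5:ℤ) ∣ x - (a i - 2 * b i)) :
    ∑' p, f p = ∑ i : Fin 5, ∑' w : ℤ × ℤ, f (a i + 2 * w.1 - w.2, b i + w.1 + 2 * w.2) := by
  have hb : Function.Bijective (fun r : Fin 5 × (ℤ × ℤ) =>
      ((a r.1 + 2 * r.2.1 - r.2.2, b r.1 + r.2.1 + 2 * r.2.2) : ℤ × ℤ)) := by
    constructor
    · rintro ⟨r, u, v⟩ ⟨r', u', v'⟩ hh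
      simp only [Prod.mk.injEq] at hh
      have : r = r' := h r r' (by omega)
      subst this
      simp only [Prod.mk.injEq, true_and]; omega
    · rintro ⟨x, y⟩
      obtain ⟨i, hi⟩ := h' (x - 2 * y)
      refine ⟨(i, (2 * (x - a i) + (y - b i)) / 5, (2 * (y - b i) - (x - a i)) / 5), ?_⟩
      simp only [Prod.mk.injEq]; omega
  have := (Equiv.ofBijective _ hb).tsum_eq f
  rw [← this]
  have hs : Summable fun r => f (Equiv.ofBijective _ hb r) := (Equiv.summable_iff _).2 hf
  rw [hs.tsum_prod, tsum_fintype]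
  rfl

/-- shifted double theta -/
lemma th_mul_shift {q : ℂ} (hq : q ≠ 0) (h1 : ‖q‖ < 1) (α α' : ℕ) (hα : α ≠ 0) (hα' : α' ≠ 0) (β β' : ℤ) (c : ℕ)
    (e : ℤ × ℤ → ℤ) (he : ∀ p, e p = (((α:ℤ) * p.1 ^ 2 + β * p.1) + ((α':ℤ) * p.2 ^ 2 + β' * p.2)) + c) :
    ∑' p, q ^ (e p) = q ^ c * (th q α β * th q α' β') := by
  rw [th_mul hq h1 α α' hα hα', ← tsum_mul_left]
  congr 1; ext p
  rw [he, zpow_add₀ hq, zpow_natCast, mul_comm]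

lemma R1 {q : ℂ} (hq : q ≠ 0) (h1 : ‖q‖ < 1) : th q 1 0 ^ 2 = th q 5 0 ^ 2 + 4 * (q * (th q 5 4 * th q 5 2)) := by
  rw [sq, th_mul hq h1 1 1 (by norm_num) (by norm_num),
    dis5 _ (th_mul_summable hq h1 1 1 (by norm_num) (by norm_num) 0 0) ![0,1,-1,0,0] ![0,0,0,1,-1]
    (by decide) (by
      intro x
      have : x % 5 = 0 ∨ x % 5 = 1 ∨ x % 5 = 2 ∨ x % 5 = 3 ∨ x % 5 = 4 := by omega
      rcases this with h | h | h | h | h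
      · exact ⟨0, by simp; omega⟩
      · exact ⟨1, by simp; omega⟩
      · exact ⟨4, by simp; omega⟩
      · exact ⟨3, by simp; omega⟩
      · exact ⟨2, by simp; omega⟩)]
  rw [Fin.sum_univ_five]
  rw [th_mul_shift hq h1 5 5 (by norm_num) (by norm_num) 0 0 0 _ (fun p => by simp; ring),
    th_mul_shift hq h1 5 5 (by norm_num) (by norm_num) 4 (-2) 1 _ (fun p => by simp; ring),
    th_mul_shift hq h1 5 5 (by norm_num) (by norm_num) (-4) (2) 1 _ (fun p => by simp; ring),
    th_mul_shift hq h1 5 5 (by norm_num) (by norm_num) 2 4 1 _ (fun p => by simp; ring),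
    th_mul_shift hq h1 5 5 (by norm_num) (by norm_num) (-2) (-4) 1 _ (fun p => by simp; ring)]
  rw [th_neg, th_neg]; ring

lemma R2 {q : ℂ} (hq : q ≠ 0) (h1 : ‖q‖ < 1) : th q 1 1 ^ 2 = q ^ 2 * th q 5 5 ^ 2 + 4 * (th q 5 3 * th q 5 1) := by
  rw [sq, th_mul hq h1 1 1 (by norm_num) (by norm_num),
    dis5 _ (th_mul_summable hq h1 1 1 (by norm_num) (by norm_num) 1 1) ![0,0,0,-1,-1] ![1,0,-1,0,-1]
    (by decide) (by
      intro x
      have : x % 5 = 0 ∨ x % 5 = 1 ∨ x % 5 = 2 ∨ x % 5 = 3 ∨ x % 5 = 4 := by omega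
      rcases this with h | h | h | h | h
      · exact ⟨1, by simp; omega⟩
      · exact ⟨4, by simp; omega⟩
      · exact ⟨2, by simp; omega⟩
      · exact ⟨0, by simp; omega⟩
      · exact ⟨3, by simp; omega⟩)]
  rw [Fin.sum_univ_five]
  rw [th_mul_shift hq h1 5 5 (by norm_num) (by norm_num) 5 5 2 _ (fun p => by simp; ring),
    th_mul_shift hq h1 5 5 (by norm_num) (by norm_num) 3 1 0 _ (fun p => by simp; ring),
    th_mul_shift hq h1 5 5 (by norm_num) (by norm_num) (1) (-3) 0 _ (fun p => by simp; ring),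
    th_mul_shift hq h1 5 5 (by norm_num) (by norm_num) (-1) 3 0 _ (fun p => by simp; ring),
    th_mul_shift hq h1 5 5 (by norm_num) (by norm_num) (-3) (-1) 0 _ (fun p => by simp; ring)]
  rw [th_neg, th_neg]; ring

lemma R3 {q : ℂ} (hq : q ≠ 0) (h1 : ‖q‖ < 1) : th q 5 4 * th q 5 2 = th q 10 6 * th q 10 2 + q * (th q 10 4 * th q 10 8) := by
  rw [← th_neg q 5 4, ← th_neg q 5 2, th_mul hq h1 5 5 (by norm_num) (by norm_num),
    dis2 _ (th_mul_summable hq h1 5 5 (by norm_num) (by norm_num) (-4) (-2))]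
  rw [th_mul_shift hq h1 10 10 (by norm_num) (by norm_num) (-6) (-2) 0 _ (fun p => by simp; ring),
    th_mul_shift hq h1 10 10 (by norm_num) (by norm_num) 4 8 1 _ (fun p => by simp; ring)]
  rw [th_neg, th_neg]; ring

lemma R4 {q : ℂ} (hq : q ≠ 0) (h1 : ‖q‖ < 1) : th q 1 0 ^ 2 = th q 2 0 ^ 2 + q * th q 2 2 ^ 2 := by
  rw [sq, th_mul hq h1 1 1 (by norm_num) (by norm_num),
    dis2 _ (th_mul_summable hq h1 1 1 (by norm_num) (by norm_num) 0 0)]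
  rw [th_mul_shift hq h1 2 2 (by norm_num) (by norm_num) 0 0 0 _ (fun p => by simp; ring),
    th_mul_shift hq h1 2 2 (by norm_num) (by norm_num) 2 2 1 _ (fun p => by simp; ring)]
  ring

lemma ev_phi {q : ℂ} (hq : q ≠ 0) (h1 : ‖q‖ < 1) :
    th q 1 0 = eu (q^2) ^ 5 / (eu q ^ 2 * eu (q ^ 4) ^ 2) := by
  rw [th_prod hq h1 1 1 1 0 (by norm_num) (by norm_num) (by norm_num), pow_one, mul_one, qpoch_odd h1]
  have := eu_ne h1
  have := eu_ne (npow_lt h1 (k := 4) (by norm_num))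
  field_simp

lemma ev_psi {q : ℂ} (hq : q ≠ 0) (h1 : ‖q‖ < 1) :
    th q 1 1 = 2 * (eu (q^4) ^ 2 / eu (q ^ 2)) := by
  have h2 := npow_lt h1 (k := 2) (by norm_num)
  rw [th_prod hq h1 1 2 0 1 (by norm_num) (by norm_num) (by norm_num), pow_zero, mul_one,
    qpoch_neg_one h2, qpoch_all h2, ← pow_mul]
  norm_num
  have := eu_ne h2
  field_simp

lemma ev_X {q : ℂ} (hq : q ≠ 0) (h1 : ‖q‖ < 1) :
    th q 5 4 * th q 5 2 = eu (q^2) ^ 2 * eu (q ^ 5) * eu (q ^ 20) / (eu q * eu (q ^ 4)) := by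
  have h2 := npow_lt h1 (k := 2) (by norm_num)
  have h5 := npow_lt h1 (k := 5) (by norm_num)
  rw [th_prod hq h1 5 9 1 4 (by norm_num) (by norm_num) (by norm_num),
    th_prod hq h1 5 7 3 2 (by norm_num) (by norm_num) (by norm_num)]
  have hs := qpoch_split 5 (by norm_num) (-q) h2
  rw [qpoch_odd h1, Fin.prod_univ_five] at hs
  have h3 := qpoch_odd h5
  simp only [← pow_mul] at hs h3
  norm_num at hs h3 ⊢
  have e3 : q * q ^ 2 = q ^ 3 := by ring
  have e5 : q * q ^ 4 = q ^ 5 := by ring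
  have e7 : q * q ^ 6 = q ^ 7 := by ring
  have e9 : q * q ^ 8 = q ^ 9 := by ring
  rw [e3, e5, e7, e9, h3] at hs
  have n1 := eu_ne h1
  have n4 := eu_ne (npow_lt h1 (k := 4) (by norm_num))
  have n5 := eu_ne h5
  have n10 := eu_ne (npow_lt h1 (k := 10) (by norm_num))
  have n20 := eu_ne (npow_lt h1 (k := 20) (by norm_num))
  have : eu (q^2) ^ 2 * eu (q ^ 5) * eu (q ^ 20) / (eu q * eu (q ^ 4)) =
    (eu (q^2) ^ 2 / (eu q * eu (q ^ 4))) * (eu (q ^ 5) * eu (q ^ 20)) := by ring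
  rw [this, hs]
  field_simp

lemma ev_Y {q : ℂ} (hq : q ≠ 0) (h1 : ‖q‖ < 1) :
    th q 5 3 * th q 5 1 = eu (q^4) * eu (q ^ 10) ^ 3 / (eu (q ^ 2) * eu (q ^ 20)) := by
  have h2 := npow_lt h1 (k := 2) (by norm_num)
  have h10 := npow_lt h1 (k := 10) (by norm_num)
  rw [th_prod hq h1 5 8 2 3 (by norm_num) (by norm_num) (by norm_num),
    th_prod hq h1 5 6 4 1 (by norm_num) (by norm_num) (by norm_num)]
  have hs := qpoch_split 5 (by norm_num) (-q^2) h2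
  rw [qpoch_all h2, Fin.prod_univ_five] at hs
  have h3 := qpoch_all h10
  simp only [← pow_mul] at hs h3
  norm_num at hs h3 ⊢
  have e3 : q ^ 2 * q ^ 2 = q ^ 4 := by ring
  have e5 : q ^ 2 * q ^ 4 = q ^ 6 := by ring
  have e7 : q ^ 2 * q ^ 6 = q ^ 8 := by ring
  have e9 : q ^ 2 * q ^ 8 = q ^ 10 := by ring
  rw [e3, e5, e7, e9, h3] at hs
  have n2 := eu_ne h2
  have n10 := eu_ne h10
  have n20 := eu_ne (npow_lt h1 (k := 20) (by norm_num))
  have : eu (q^4) * eu (q ^ 10) ^ 3 / (eu (q ^ 2) * eu (q ^ 20)) =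
    (eu (q^4) / eu (q ^ 2)) * (eu (q ^ 10) ^ 3 / eu (q ^ 20)) := by ring
  rw [this, hs]
  field_simp

lemma H1 {q : ℂ} (hq : q ≠ 0) (h1 : ‖q‖ < 1) :
    (eu (q^2) ^ 5 / (eu q ^ 2 * eu (q ^ 4) ^ 2)) ^ 2 =
      (eu (q^10) ^ 5 / (eu (q^5) ^ 2 * eu (q ^ 20) ^ 2)) ^ 2 +
      4 * q * (eu (q^2) ^ 2 * eu (q ^ 5) * eu (q ^ 20) / (eu q * eu (q ^ 4))) := by
  have h := R1 hq h1
  have e := ev_phi (q := q ^ 5) (pow_ne_zero _ hq) (npow_lt h1 (by norm_num))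
  rw [th_pow] at e
  simp only [← pow_mul] at e
  norm_num at e
  rw [ev_phi hq h1, ev_X hq h1, e] at h
  rw [h]; ring

lemma H2 {q : ℂ} (hq : q ≠ 0) (h1 : ‖q‖ < 1) :
    (eu (q^4) ^ 2 / eu (q ^ 2)) ^ 2 = q ^ 2 * (eu (q^20) ^ 2 / eu (q ^ 10)) ^ 2 +
      eu (q^4) * eu (q ^ 10) ^ 3 / (eu (q ^ 2) * eu (q ^ 20)) := by
  have h := R2 hq h1
  have e := ev_psi (q := q ^ 5) (pow_ne_zero _ hq) (npow_lt h1 (by norm_num))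
  rw [th_pow] at e
  simp only [← pow_mul] at e
  norm_num at e
  rw [ev_psi hq h1, ev_Y hq h1, e] at h
  linear_combination h / 4

lemma H3 {q : ℂ} (hq : q ≠ 0) (h1 : ‖q‖ < 1) :
    eu (q^2) ^ 2 * eu (q ^ 5) * eu (q ^ 20) / (eu q * eu (q ^ 4)) =
      eu (q^8) * eu (q ^ 20) ^ 3 / (eu (q ^ 4) * eu (q ^ 40)) +
      q * (eu (q^4) ^ 2 * eu (q ^ 10) * eu (q ^ 40) / (eu (q ^ 2) * eu (q ^ 8))) := by
  have h := R3 hq h1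
  have e := ev_Y (q := q ^ 2) (pow_ne_zero _ hq) (npow_lt h1 (by norm_num))
  have e' := ev_X (q := q ^ 2) (pow_ne_zero _ hq) (npow_lt h1 (by norm_num))
  simp only [th_pow] at e e'
  simp only [← pow_mul] at e e'
  norm_num at e e'
  rw [ev_X hq h1, e, mul_comm (th q 10 4), e'] at h
  exact h

lemma H4 {q : ℂ} (hq : q ≠ 0) (h1 : ‖q‖ < 1) :
    (eu (q^2) ^ 5 / (eu q ^ 2 * eu (q ^ 4) ^ 2)) ^ 2 =
      (eu (q^4) ^ 5 / (eu (q^2) ^ 2 * eu (q ^ 8) ^ 2)) ^ 2 +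
      4 * q * (eu (q^8) ^ 2 / eu (q ^ 4)) ^ 2 := by
  have h := R4 hq h1
  have e := ev_phi (q := q ^ 2) (pow_ne_zero _ hq) (npow_lt h1 (by norm_num))
  have e' := ev_psi (q := q ^ 2) (pow_ne_zero _ hq) (npow_lt h1 (by norm_num))
  simp only [th_pow] at e e'
  simp only [← pow_mul] at e e'
  norm_num at e e'
  rw [ev_phi hq h1, e, e'] at h
  rw [h]; ring

lemma npow_two (q : ℂ) : (-q) ^ 2 = q ^ 2 := by ring
lemma npow_four (q : ℂ) : (-q) ^ 4 = q ^ 4 := by ring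
lemma npow_five (q : ℂ) : (-q) ^ 5 = -(q ^ 5) := by ring
lemma npow_eight (q : ℂ) : (-q) ^ 8 = q ^ 8 := by ring
lemma npow_ten (q : ℂ) : (-q) ^ 10 = q ^ 10 := by ring
lemma npow_twenty (q : ℂ) : (-q) ^ 20 = q ^ 20 := by ring
lemma npow_forty (q : ℂ) : (-q) ^ 40 = q ^ 40 := by ring

lemma eu_neg5 {q : ℂ} (hq : ‖q‖ < 1) :
    eu (-(q ^ 5)) = eu (q ^ 10) ^ 3 / (eu (q ^ 5) * eu (q ^ 20)) := by
  have := eu_neg (npow_lt hq (k := 5) (by norm_num))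
  simp only [← pow_mul] at this
  norm_num at this
  exact this

lemma eun {q : ℂ} (hq : ‖q‖ < 1) (k : ℕ) (hk : k ≠ 0) : eu (q ^ k) ≠ 0 := eu_ne (npow_lt hq hk)

lemma H1n {q : ℂ} (hq : q ≠ 0) (h1 : ‖q‖ < 1) :
    (eu q ^ 2 / eu (q ^ 2)) ^ 2 = (eu (q ^ 5) ^ 2 / eu (q ^ 10)) ^ 2 -
      4 * q * (eu q * eu (q ^ 10) ^ 3 / (eu (q ^ 2) * eu (q ^ 5))) := by
  have h := H1 (q := -q) (neg_ne_zero.2 hq) (by simpa using h1)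
  simp only [npow_two, npow_four, npow_five, npow_ten, npow_twenty, eu_neg h1, eu_neg5 h1] at h
  have n1 := eu_ne h1
  have n2 := eun h1 2 (by norm_num)
  have n4 := eun h1 4 (by norm_num)
  have n5 := eun h1 5 (by norm_num)
  have n10 := eun h1 10 (by norm_num)
  have n20 := eun h1 20 (by norm_num)
  generalize eu q = f1 at *
  generalize eu (q ^ 2) = f2 at *
  generalize eu (q ^ 4) = f4 at *
  generalize eu (q ^ 5) = f5 at *
  generalize eu (q ^ 10) = f10 at *
  generalize eu (q ^ 20) = f20 at *
  have e1 : (f2 ^ 5 / ((f2 ^ 3 / (f1 * f4)) ^ 2 * f4 ^ 2)) = f1 ^ 2 / f2 := by field_simp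
  have e2 : (f10 ^ 5 / ((f10 ^ 3 / (f5 * f20)) ^ 2 * f20 ^ 2)) = f5 ^ 2 / f10 := by field_simp
  have e3 : f2 ^ 2 * (f10 ^ 3 / (f5 * f20)) * f20 / (f2 ^ 3 / (f1 * f4) * f4)
    = f1 * f10 ^ 3 / (f2 * f5) := by field_simp
  rw [e1, e2, e3] at h
  rw [h]; ring

lemma H3n {q : ℂ} (hq : q ≠ 0) (h1 : ‖q‖ < 1) :
    eu q * eu (q ^ 10) ^ 3 / (eu (q ^ 2) * eu (q ^ 5)) =
      eu (q^8) * eu (q ^ 20) ^ 3 / (eu (q ^ 4) * eu (q ^ 40)) -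
      q * (eu (q^4) ^ 2 * eu (q ^ 10) * eu (q ^ 40) / (eu (q ^ 2) * eu (q ^ 8))) := by
  have h := H3 (q := -q) (neg_ne_zero.2 hq) (by simpa using h1)
  simp only [npow_two, npow_four, npow_five, npow_eight, npow_ten, npow_twenty, npow_forty,
    eu_neg h1, eu_neg5 h1] at h
  have n1 := eu_ne h1
  have n2 := eun h1 2 (by norm_num)
  have n4 := eun h1 4 (by norm_num)
  have n5 := eun h1 5 (by norm_num)
  have n20 := eun h1 20 (by norm_num)
  have e3 : eu (q ^ 2) ^ 2 * (eu (q ^ 10) ^ 3 / (eu (q ^ 5) * eu (q ^ 20))) * eu (q ^ 20) /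
    (eu (q ^ 2) ^ 3 / (eu q * eu (q ^ 4)) * eu (q ^ 4))
    = eu q * eu (q ^ 10) ^ 3 / (eu (q ^ 2) * eu (q ^ 5)) := by field_simp
  rw [e3] at h
  rw [h]; ring

lemma H4n {q : ℂ} (hq : q ≠ 0) (h1 : ‖q‖ < 1) :
    (eu q ^ 2 / eu (q ^ 2)) ^ 2 =
      (eu (q^4) ^ 5 / (eu (q^2) ^ 2 * eu (q ^ 8) ^ 2)) ^ 2 -
      4 * q * (eu (q^8) ^ 2 / eu (q ^ 4)) ^ 2 := by
  have h := H4 (q := -q) (neg_ne_zero.2 hq) (by simpa using h1)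
  simp only [npow_two, npow_four, npow_eight, eu_neg h1] at h
  have n1 := eu_ne h1
  have n2 := eun h1 2 (by norm_num)
  have n4 := eun h1 4 (by norm_num)
  have e1 : eu (q ^ 2) ^ 5 / ((eu (q ^ 2) ^ 3 / (eu q * eu (q ^ 4))) ^ 2 * eu (q ^ 4) ^ 2) =
    eu q ^ 2 / eu (q ^ 2) := by field_simp
  rw [e1] at h
  rw [h]; ring

/-- `φ(q)^4 - φ(-q)^4 = 16 q ψ(q²)^4` -/
lemma quartic {q : ℂ} (hq : q ≠ 0) (h1 : ‖q‖ < 1) :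
    (eu (q^2) ^ 5 / (eu q ^ 2 * eu (q ^ 4) ^ 2)) ^ 4 - (eu q ^ 2 / eu (q ^ 2)) ^ 4 =
      16 * q * (eu (q ^ 4) ^ 2 / eu (q ^ 2)) ^ 4 := by
  have h := H4 hq h1
  have h' := H4n hq h1
  have n1 := eu_ne h1
  have n2 := eun h1 2 (by norm_num)
  have n4 := eun h1 4 (by norm_num)
  have n8 := eun h1 8 (by norm_num)
  have e : (eu (q^4) ^ 5 / (eu (q^2) ^ 2 * eu (q ^ 8) ^ 2)) * (eu (q^8) ^ 2 / eu (q ^ 4)) =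
    (eu (q ^ 4) ^ 2 / eu (q ^ 2)) ^ 2 := by field_simp
  have e4 : (eu (q ^ 4) ^ 2 / eu (q ^ 2)) ^ 4 = ((eu (q ^ 4) ^ 2 / eu (q ^ 2)) ^ 2) ^ 2 := by ring
  rw [e4, ← e]
  generalize (eu (q^4) ^ 5 / (eu (q^2) ^ 2 * eu (q ^ 8) ^ 2)) = x at *
  generalize (eu (q^8) ^ 2 / eu (q ^ 4)) = y at *
  generalize (eu (q^2) ^ 5 / (eu q ^ 2 * eu (q ^ 4) ^ 2)) = a at *
  generalize (eu q ^ 2 / eu (q ^ 2)) = b at *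
  have : a ^ 4 - b ^ 4 = (a ^ 2) ^ 2 - (b ^ 2) ^ 2 := by ring
  rw [this, h, h']; ring

lemma cross_alg (u v n t : ℂ) (hw : u * v = n ^ 2) (hm : u + v = n ^ 2 - 4 * n + 5)
    (ht : t * (1 - n) = 5 - n) :
    (u - 1) * (5 - u) * (t ^ 2 - v ^ 2) = (1 - v) * (5 - v) * (t ^ 2 - u ^ 2) := by
  have hn : (1 - n) ≠ 0 := by
    intro h
    rw [h] at ht
    have : (4 : ℂ) = 0 := by linear_combination -ht - h
    norm_num at this
  have e : (u - 1) * (5 - u) * (t ^ 2 - v ^ 2) - (1 - v) * (5 - v) * (t ^ 2 - u ^ 2) =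
    t ^ 2 * (-(u + v) ^ 2 + 2 * (u * v) + 6 * (u + v) - 10) + 2 * (u * v) ^ 2
      - 6 * (u * v) * (u + v) + 5 * (u + v) ^ 2 - 10 * (u * v) := by ring
  rw [hw, hm] at e
  have ht' : t = (5 - n) / (1 - n) := by rw [eq_div_iff hn, ht]
  have e2 : t ^ 2 * (-(n ^ 2 - 4 * n + 5) ^ 2 + 2 * n ^ 2 + 6 * (n ^ 2 - 4 * n + 5) - 10) +
      2 * (n ^ 2) ^ 2 - 6 * n ^ 2 * (n ^ 2 - 4 * n + 5) + 5 * (n ^ 2 - 4 * n + 5) ^ 2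
      - 10 * n ^ 2 = 0 := by
    rw [ht']; field_simp; ring
  rw [e2] at e
  linear_combination e

lemma K_alg (q a b A B p s X X' : ℂ) (hq : q ≠ 0) (hA : A ≠ 0) (hB : B ≠ 0) (hs : s ≠ 0)
    (e1 : a ^ 2 = A ^ 2 + 4 * q * X) (e2 : b ^ 2 = B ^ 2 - 4 * q * X')
    (e3 : a * b * (A * B) = (A * B) ^ 2 - 4 * q ^ 2 * (X * X'))
    (e4 : X * X' * (p ^ 2 - q ^ 2 * s ^ 2) = A ^ 2 * B ^ 2 * s ^ 2)
    (e5 : a ^ 4 - b ^ 4 = 16 * q * p ^ 4) (e6 : A ^ 4 - B ^ 4 = 16 * q ^ 5 * s ^ 4)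
    (ne : p ^ 4 * A ^ 4 ≠ q ^ 4 * s ^ 4 * a ^ 4) :
    X * (A ^ 2 - q * X) = X' * (B ^ 2 + q * X') := by
  have hX : X = (a ^ 2 - A ^ 2) / (4 * q) := by field_simp; linear_combination -e1
  have hX' : X' = (B ^ 2 - b ^ 2) / (4 * q) := by field_simp; linear_combination e2
  have F : (a ^ 2 - A ^ 2) * (B ^ 2 - b ^ 2) = 4 * ((A * B) ^ 2 - a * b * (A * B)) := by
    have : (a ^ 2 - A ^ 2) * (B ^ 2 - b ^ 2) = 16 * q ^ 2 * (X * X') := by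
      rw [e1, e2]; ring
    rw [this]; linear_combination 4 * e3
  have hT : (A * B - a * b) * (p ^ 2 - q ^ 2 * s ^ 2) = 4 * (A * B) * (q ^ 2 * s ^ 2) := by
    have hAB : A * B ≠ 0 := mul_ne_zero hA hB
    apply mul_left_cancel₀ hAB
    linear_combination (- (p ^ 2 - q ^ 2 * s ^ 2)) * e3 + 4 * q ^ 2 * e4
  have hc := cross_alg (a ^ 2 / A ^ 2) (b ^ 2 / B ^ 2) (a * b / (A * B)) (p ^ 2 / (q ^ 2 * s ^ 2))
    (by field_simp) (by field_simp; linear_combination F)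
    (by field_simp; linear_combination hT)
  have h1 : A ^ 4 * ((p ^ 2 / (q ^ 2 * s ^ 2)) ^ 2 - (a ^ 2 / A ^ 2) ^ 2) =
      B ^ 4 * ((p ^ 2 / (q ^ 2 * s ^ 2)) ^ 2 - (b ^ 2 / B ^ 2) ^ 2) := by
    have : p ^ 4 = (a ^ 4 - b ^ 4) / (16 * q) := by rw [e5]; field_simp
    field_simp
    rw [this]
    field_simp
    linear_combination (a ^ 4 - b ^ 4) * e6
  have h2 : (p ^ 2 / (q ^ 2 * s ^ 2)) ^ 2 - (a ^ 2 / A ^ 2) ^ 2 ≠ 0 := by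
    intro h
    apply ne
    field_simp at h
    linear_combination h
  have h3 : A ^ 4 * ((a ^ 2 / A ^ 2 - 1) * (5 - a ^ 2 / A ^ 2)) =
      B ^ 4 * ((1 - b ^ 2 / B ^ 2) * (5 - b ^ 2 / B ^ 2)) := by
    apply mul_right_cancel₀ h2
    linear_combination B ^ 4 * hc + (a ^ 2 / A ^ 2 - 1) * (5 - a ^ 2 / A ^ 2) * h1
  have h4 : (a ^ 2 - A ^ 2) * (5 * A ^ 2 - a ^ 2) = (B ^ 2 - b ^ 2) * (5 * B ^ 2 - b ^ 2) := by
    field_simp at h3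
    linear_combination h3
  rw [hX, hX']; field_simp; linear_combination h4

/-- `X(q) = f₂² f₅ f₂₀ / (f₁ f₄)`. -/
noncomputable def Xf (q : ℂ) : ℂ := eu (q^2) ^ 2 * eu (q ^ 5) * eu (q ^ 20) / (eu q * eu (q ^ 4))
/-- `X(-q)`. -/
noncomputable def Xg (q : ℂ) : ℂ := eu q * eu (q ^ 10) ^ 3 / (eu (q ^ 2) * eu (q ^ 5))
/-- `φ(q⁵)`. -/
noncomputable def Af (q : ℂ) : ℂ := eu (q^10) ^ 5 / (eu (q^5) ^ 2 * eu (q ^ 20) ^ 2)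
/-- `φ(-q⁵)`. -/
noncomputable def Bf (q : ℂ) : ℂ := eu (q ^ 5) ^ 2 / eu (q ^ 10)

lemma lemK {q : ℂ} (hq : q ≠ 0) (h1 : ‖q‖ < 1)
    (ne : (eu (q ^ 4) ^ 2 / eu (q ^ 2)) ^ 4 * (Af q) ^ 4 ≠
      q ^ 4 * (eu (q ^ 20) ^ 2 / eu (q ^ 10)) ^ 4 *
        (eu (q^2) ^ 5 / (eu q ^ 2 * eu (q ^ 4) ^ 2)) ^ 4) :
    Xf q * (Af q ^ 2 - q * Xf q) = Xg q * (Bf q ^ 2 + q * Xg q) := by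
  have n1 := eu_ne h1
  have n2 := eun h1 2 (by norm_num)
  have n4 := eun h1 4 (by norm_num)
  have n5 := eun h1 5 (by norm_num)
  have n10 := eun h1 10 (by norm_num)
  have n20 := eun h1 20 (by norm_num)
  have g1 := H1 hq h1
  have g2 := H1n hq h1
  have g3 := H1n (q := q ^ 2) (pow_ne_zero _ hq) (npow_lt h1 (by norm_num))
  have g4 := H2 hq h1
  have g5 := quartic hq h1
  have g6 := quartic (q := q ^ 5) (pow_ne_zero _ hq) (npow_lt h1 (by norm_num))
  simp only [← pow_mul] at g3 g6
  norm_num at g3 g6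
  unfold Xf Xg Af Bf at *
  generalize eu q = f1 at *
  generalize eu (q ^ 2) = f2 at *
  generalize eu (q ^ 4) = f4 at *
  generalize eu (q ^ 5) = f5 at *
  generalize eu (q ^ 10) = f10 at *
  generalize eu (q ^ 20) = f20 at *
  refine K_alg q (f2 ^ 5 / (f1 ^ 2 * f4 ^ 2)) (f1 ^ 2 / f2) _ _ (f4 ^ 2 / f2) (f20 ^ 2 / f10) _ _
    hq (by positivity) (by positivity) (by positivity) g1 g2 ?_ ?_ g5 ?_ ne
  · have i1 : f2 ^ 5 / (f1 ^ 2 * f4 ^ 2) * (f1 ^ 2 / f2) = (f2 ^ 2 / f4) ^ 2 := by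
      field_simp
    have i2 : f10 ^ 5 / (f5 ^ 2 * f20 ^ 2) * (f5 ^ 2 / f10) = (f10 ^ 2 / f20) ^ 2 := by
      field_simp
    rw [i1, i2, g3]
    field_simp
  · have : (f4 ^ 2 / f2) ^ 2 - q ^ 2 * (f20 ^ 2 / f10) ^ 2 = f4 * f10 ^ 3 / (f2 * f20) := by
      rw [g4]; ring
    rw [this]
    field_simp
  · rw [g6]

noncomputable def Ef (q : ℂ) : ℂ := eu (q ^ 10) ^ 4 / (eu q * eu (q ^ 5) ^ 3) *
  (Af q ^ 2 * Xf q - 4 * q ^ 2 * (eu (q ^ 4) * eu (q ^ 10) * eu (q ^ 20) ^ 3 / eu (q ^ 2)))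

lemma psiNeg_eq (q : ℂ) : psiNeg q = eu q * eu (q ^ 4) / eu (q ^ 2) := rfl

lemma psi5_eq (q : ℂ) : psiNeg (q ^ 5) = eu (q ^ 5) * eu (q ^ 20) / eu (q ^ 10) := by
  rw [psiNeg_eq]; simp only [← pow_mul]

lemma Bpos {q : ℂ} (h1 : ‖q‖ < 1) : psiNeg (q ^ 5) ^ 5 / psiNeg q =
    eu (q ^ 20) ^ 4 / (eu (q ^ 2) * eu (q ^ 10) ^ 3) * (Xf q * Bf q ^ 2) := by
  have n1 := eu_ne h1
  have n2 := eun h1 2 (by norm_num)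
  have n4 := eun h1 4 (by norm_num)
  have n5 := eun h1 5 (by norm_num)
  have n10 := eun h1 10 (by norm_num)
  have n20 := eun h1 20 (by norm_num)
  rw [psi5_eq, psiNeg_eq]
  unfold Xf Bf
  field_simp

lemma Bneg {q : ℂ} (h1 : ‖q‖ < 1) : psiNeg ((-q) ^ 5) ^ 5 / psiNeg (-q) =
    eu (q ^ 20) ^ 4 / (eu (q ^ 2) * eu (q ^ 10) ^ 3) * (Xg q * Af q ^ 2) := by
  have n1 := eu_ne h1
  have n2 := eun h1 2 (by norm_num)
  have n4 := eun h1 4 (by norm_num)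
  have n5 := eun h1 5 (by norm_num)
  have n10 := eun h1 10 (by norm_num)
  have n20 := eun h1 20 (by norm_num)
  rw [psi5_eq, psiNeg_eq]
  simp only [npow_two, npow_four, npow_five, npow_ten, npow_twenty, eu_neg h1, eu_neg5 h1]
  unfold Xg Af
  field_simp

lemma idMid {q : ℂ} (hq : q ≠ 0) (h1 : ‖q‖ < 1) :
    eu (q ^ 20) ^ 4 / (eu (q ^ 2) * eu (q ^ 10) ^ 3) * (Xf q * Bf q ^ 2 - Xg q * Af q ^ 2)
      = 2 * q * Ef (q ^ 2) := by
  have n1 := eu_ne h1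
  have n2 := eun h1 2 (by norm_num)
  have n4 := eun h1 4 (by norm_num)
  have n5 := eun h1 5 (by norm_num)
  have n8 := eun h1 8 (by norm_num)
  have n10 := eun h1 10 (by norm_num)
  have n20 := eun h1 20 (by norm_num)
  have n40 := eun h1 40 (by norm_num)
  have g1 : Xf q = _ := H3 hq h1
  have g2 : Xg q = _ := H3n hq h1
  have g3 := H4 (q := q ^ 5) (pow_ne_zero _ hq) (npow_lt h1 (by norm_num))
  have g4 := H4n (q := q ^ 5) (pow_ne_zero _ hq) (npow_lt h1 (by norm_num))
  simp only [← pow_mul] at g3 g4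
  norm_num at g3 g4
  have g3' : Af q ^ 2 = _ := g3
  have g4' : Bf q ^ 2 = _ := g4
  rw [g1, g2, g3', g4']
  unfold Ef Af Xf
  simp only [← pow_mul]
  norm_num
  clear g1 g2 g3 g4 g3' g4'
  generalize eu (q ^ 2) = f2 at *
  generalize eu (q ^ 4) = f4 at *
  generalize eu (q ^ 8) = f8 at *
  generalize eu (q ^ 10) = f10 at *
  generalize eu (q ^ 20) = f20 at *
  generalize eu (q ^ 40) = f40 at *
  field_simp
  ring

lemma idOdd {q : ℂ} (hq : q ≠ 0) (h1 : ‖q‖ < 1) :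
    psiNeg (q ^ 5) ^ 5 / psiNeg q - psiNeg ((-q) ^ 5) ^ 5 / psiNeg (-q) = 2 * q * Ef (q ^ 2) := by
  rw [Bpos h1, Bneg h1, ← idMid hq h1]; ring

lemma fin_alg (q X X' P N K r : ℂ) (hX : X ≠ 0) (hX' : X' ≠ 0) (hP : P ≠ 0) (hN : N ≠ 0)
    (hD : X * (P - q * X) = X' * (N + q * X')) (hK : 4 * q ^ 2 * K = q * (X ^ 2 - X' ^ 2)) :
    r / (X' * N) * (P * X - 4 * q ^ 2 * K) + r / (X * P) * (N * X' - 4 * q ^ 2 * K) =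
      2 * r - 2 * q * (r / (P * N) * (X * N - X' * P)) := by
  have hX2 : q * (X ^ 2 + X' ^ 2) = X * P - X' * N := by linear_combination -hD
  rw [hK]
  field_simp
  linear_combination r * (X * P - X' * N) * (-hX2)

lemma idEven {q : ℂ} (hq : q ≠ 0) (h1 : ‖q‖ < 1)
    (ne : (eu (q ^ 4) ^ 2 / eu (q ^ 2)) ^ 4 * (Af q) ^ 4 ≠
      q ^ 4 * (eu (q ^ 20) ^ 2 / eu (q ^ 10)) ^ 4 *
        (eu (q^2) ^ 5 / (eu q ^ 2 * eu (q ^ 4) ^ 2)) ^ 4) :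
    Ef q + Ef (-q) = 2 * (eu (q ^ 10) ^ 5 / eu (q ^ 2)) - 4 * q ^ 2 * Ef (q ^ 2) := by
  have hK := lemK hq h1 ne
  clear ne
  have hM := idMid hq h1
  have n1 := eu_ne h1
  have n2 := eun h1 2 (by norm_num)
  have n4 := eun h1 4 (by norm_num)
  have n5 := eun h1 5 (by norm_num)
  have n8 := eun h1 8 (by norm_num)
  have n10 := eun h1 10 (by norm_num)
  have n20 := eun h1 20 (by norm_num)
  have n40 := eun h1 40 (by norm_num)
  have g1 : Xf q = _ := H3 hq h1
  have g2 : Xg q = _ := H3n hq h1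
  have hK2 : 4 * q ^ 2 * (eu (q ^ 4) * eu (q ^ 10) * eu (q ^ 20) ^ 3 / eu (q ^ 2)) =
      q * (Xf q ^ 2 - Xg q ^ 2) := by
    rw [g1, g2]
    field_simp
    ring
  clear g1 g2
  have e1 : Ef q = (eu (q ^ 10) ^ 5 / eu (q ^ 2)) / (Xg q * Bf q ^ 2) *
      (Af q ^ 2 * Xf q - 4 * q ^ 2 * (eu (q ^ 4) * eu (q ^ 10) * eu (q ^ 20) ^ 3 / eu (q ^ 2))) := by
    unfold Ef
    congr 1
    unfold Xg Bf
    field_simp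
  have x1 : Xf (-q) = Xg q := by
    unfold Xf Xg
    simp only [npow_two, npow_four, npow_five, npow_ten, npow_twenty, eu_neg h1, eu_neg5 h1]
    field_simp
  have x2 : Af (-q) = Bf q := by
    unfold Af Bf
    simp only [npow_two, npow_four, npow_five, npow_ten, npow_twenty, eu_neg h1, eu_neg5 h1]
    field_simp
  have e2 : Ef (-q) = (eu (q ^ 10) ^ 5 / eu (q ^ 2)) / (Xf q * Af q ^ 2) *
      (Bf q ^ 2 * Xg q - 4 * q ^ 2 * (eu (q ^ 4) * eu (q ^ 10) * eu (q ^ 20) ^ 3 / eu (q ^ 2))) := by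
    unfold Ef
    rw [x1, x2]
    simp only [npow_two, npow_four, npow_five, npow_ten, npow_twenty, eu_neg h1, eu_neg5 h1]
    congr 1
    unfold Xf Af
    field_simp
  have e3 : eu (q ^ 20) ^ 4 / (eu (q ^ 2) * eu (q ^ 10) ^ 3) =
      (eu (q ^ 10) ^ 5 / eu (q ^ 2)) / (Af q ^ 2 * Bf q ^ 2) := by
    unfold Af Bf
    field_simp
  have e4 : 4 * q ^ 2 * Ef (q ^ 2) = 2 * q * (2 * q * Ef (q ^ 2)) := by ring
  rw [e4, ← hM, e1, e2, e3]
  refine fin_alg q (Xf q) (Xg q) (Af q ^ 2) (Bf q ^ 2) _ _ ?_ ?_ ?_ ?_ hK hK2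
  · unfold Xf
    exact div_ne_zero (mul_ne_zero (mul_ne_zero (pow_ne_zero _ n2) n5) n20) (mul_ne_zero n1 n4)
  · unfold Xg
    exact div_ne_zero (mul_ne_zero n1 (pow_ne_zero _ n10)) (mul_ne_zero n2 n5)
  · unfold Af
    exact pow_ne_zero _ (div_ne_zero (pow_ne_zero _ n10)
      (mul_ne_zero (pow_ne_zero _ n5) (pow_ne_zero _ n20)))
  · unfold Bf
    exact pow_ne_zero _ (div_ne_zero (pow_ne_zero _ n5) n10)

lemma eu_cont_pow (k : ℕ) (hk : k ≠ 0) : ContinuousAt (fun q : ℂ => eu (q ^ k)) 0 := by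
  have h0 : (0 : ℂ) ^ k = 0 := zero_pow hk
  have := ContinuousAt.comp (f := fun q : ℂ => q ^ k) (g := eu) (x := 0) (by simpa [h0] using eu_cont)
    (by fun_prop)
  exact this

lemma small_ne : ∀ᶠ q : ℂ in nhds 0, (eu (q ^ 4) ^ 2 / eu (q ^ 2)) ^ 4 * (Af q) ^ 4 ≠
      q ^ 4 * (eu (q ^ 20) ^ 2 / eu (q ^ 10)) ^ 4 *
        (eu (q^2) ^ 5 / (eu q ^ 2 * eu (q ^ 4) ^ 2)) ^ 4 := by
  have c1 := eu_cont
  have c2 := eu_cont_pow 2 (by norm_num)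
  have c4 := eu_cont_pow 4 (by norm_num)
  have c5 := eu_cont_pow 5 (by norm_num)
  have c10 := eu_cont_pow 10 (by norm_num)
  have c20 := eu_cont_pow 20 (by norm_num)
  have cA : ContinuousAt Af 0 := by
    unfold Af
    refine (c10.pow 5).div ((c5.pow 2).mul (c20.pow 2)) ?_
    simp [eu_zero]
  have cp : ContinuousAt (fun q : ℂ => eu (q ^ 4) ^ 2 / eu (q ^ 2)) 0 :=
    (c4.pow 2).div c2 (by simp [eu_zero])
  have cs : ContinuousAt (fun q : ℂ => eu (q ^ 20) ^ 2 / eu (q ^ 10)) 0 :=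
    (c20.pow 2).div c10 (by simp [eu_zero])
  have ca : ContinuousAt (fun q : ℂ => eu (q^2) ^ 5 / (eu q ^ 2 * eu (q ^ 4) ^ 2)) 0 :=
    (c2.pow 5).div ((c1.pow 2).mul (c4.pow 2)) (by simp [eu_zero])
  have L := (cp.pow 4).mul (cA.pow 4)
  have R := ((continuousAt_id.pow 4).mul (cs.pow 4)).mul (ca.pow 4)
  exact (ContinuousAt.ne_iff_eventually_ne L R).1 (by simp [eu_zero, Af])

lemma hs_congr {f g : ℕ → ℂ} {S T : ℂ} (h : HasSum f S) (e : ∀ n, g n = f n) (eS : T = S) :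
    HasSum g T := by
  rw [eS, funext e]; exact h

lemma coeff_zero (e : ℕ → ℂ)
    (h : ∀ᶠ z : ℂ in nhds 0, z ≠ 0 → HasSum (fun n => e n * z ^ n) 0) (n : ℕ) : e n = 0 := by
  classical
  set p : FormalMultilinearSeries ℂ ℂ ℂ := FormalMultilinearSeries.ofScalars ℂ e with hp
  have hcoef : ∀ n, p.coeff n = e n := fun n => by
    simp [hp, FormalMultilinearSeries.coeff_ofScalars]
  set f : ℂ → ℂ := fun z => if z = 0 then e 0 else 0 with hf
  have hfp : HasFPowerSeriesAt f p 0 := by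
    rw [hasFPowerSeriesAt_iff]
    filter_upwards [h] with z hz
    rw [zero_add]
    by_cases h0 : z = 0
    · subst h0
      have : HasSum (fun n => (0 : ℂ) ^ n • p.coeff n) ((0 : ℂ) ^ 0 • p.coeff 0) := by
        apply hasSum_single
        intro n hn
        simp [hn]
      simpa [hf, hcoef] using this
    · have := hz h0
      simp only [hf, h0, if_false, hcoef, smul_eq_mul]
      simpa [mul_comm] using this
  have han : AnalyticAt ℂ f 0 := ⟨p, hfp⟩
  have hz : ∀ᶠ z in nhds (0 : ℂ), f z = 0 := by
    rw [← han.frequently_zero_iff_eventually_zero]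
    apply Filter.Eventually.frequently
    filter_upwards [self_mem_nhdsWithin] with z hz
    have : z ≠ 0 := hz
    simp [hf, this]
  have h0 : HasFPowerSeriesAt 0 p 0 := hfp.congr hz
  have := h0.eq_zero
  rw [← hcoef n, this]; rfl

lemma hasSum_odd (f : ℕ → ℂ) (q S S' : ℂ) (h : HasSum (fun n => f n * q ^ n) S)
    (h' : HasSum (fun n => f n * (-q) ^ n) S') :
    HasSum (fun m => f (2 * m + 1) * q ^ (2 * m + 1)) ((S - S') / 2) := by
  have hinj : Function.Injective (fun m : ℕ => 2 * m + 1) := fun a b hab => by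
    simp only at hab; omega
  have := (h.sub h').div_const 2
  rw [← hinj.hasSum_iff] at this
  · refine hs_congr this (fun m => ?_) rfl
    simp only [Function.comp, pow_succ, pow_mul, neg_sq]
    ring
  · intro n hn
    have he : Even n := by
      by_contra ho
      rw [Nat.not_even_iff_odd] at ho
      obtain ⟨k, hk⟩ := ho
      exact hn ⟨k, hk.symm⟩
    simp only [he.neg_pow]; ring

lemma hasSum_even (f : ℕ → ℂ) (q S S' : ℂ) (h : HasSum (fun n => f n * q ^ n) S)
    (h' : HasSum (fun n => f n * (-q) ^ n) S') :
    HasSum (fun m => f (2 * m) * (q ^ 2) ^ m) ((S + S') / 2) := by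
  have hinj : Function.Injective (fun m : ℕ => 2 * m) := fun a b hab => by
    simp only at hab; omega
  have := (h.add h').div_const 2
  rw [← hinj.hasSum_iff] at this
  · refine hs_congr this (fun m => ?_) rfl
    simp only [Function.comp, pow_mul, neg_sq]
    ring
  · intro n hn
    have he : Odd n := by
      by_contra ho
      rw [Nat.not_odd_iff_even] at ho
      obtain ⟨k, hk⟩ := ho
      exact hn ⟨k, by simp only; omega⟩
    simp only [he.neg_pow]; ring

lemma hasSum_of_tsum_ne {f : ℕ → ℂ} {S : ℂ} (h : ∑' n, f n = S) (hS : S ≠ 0) : HasSum f S := by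
  have : Summable f := by
    by_contra hn
    rw [tsum_eq_zero_of_not_summable hn] at h
    exact hS h.symm
  rw [← h]; exact this.hasSum

theorem stmt_12 (c b : ℕ → ℤ)
    (hc : ∀ q : ℂ, ‖q‖ < 1 →
      ∑' n : ℕ, (c n : ℂ) * q ^ n = qpoch (q ^ 5) (q ^ 5) ^ 5 / qpoch q q)
    (hb : ∀ q : ℂ, ‖q‖ < 1 →
      ∑' n : ℕ, (b n : ℂ) * q ^ n = psiNeg (q ^ 5) ^ 5 / psiNeg q) :
    ∀ n : ℕ, 0 < n → b (4 * n + 1) = c n - 2 * b (2 * n - 1) := by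
  have hC : ∀ q : ℂ, ‖q‖ < 1 → HasSum (fun n => (c n : ℂ) * q ^ n) (eu (q ^ 5) ^ 5 / eu q) :=
    fun q hq => hasSum_of_tsum_ne (hc q hq)
      (div_ne_zero (pow_ne_zero _ (eun hq 5 (by norm_num))) (eu_ne hq))
  have psn : ∀ q : ℂ, ‖q‖ < 1 → psiNeg q ≠ 0 := fun q hq => by
    rw [psiNeg_eq]
    exact div_ne_zero (mul_ne_zero (eu_ne hq) (eun hq 4 (by norm_num))) (eun hq 2 (by norm_num))
  have hB : ∀ q : ℂ, ‖q‖ < 1 → HasSum (fun n => (b n : ℂ) * q ^ n)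
      (psiNeg (q ^ 5) ^ 5 / psiNeg q) := fun q hq => hasSum_of_tsum_ne (hb q hq)
      (div_ne_zero (pow_ne_zero _ (psn _ (npow_lt hq (by norm_num)))) (psn _ hq))
  have hE : ∀ q : ℂ, q ≠ 0 → ‖q‖ < 1 → HasSum (fun m => (b (2 * m + 1) : ℂ) * q ^ m) (Ef q) := by
    intro q hq h1
    obtain ⟨z, hz⟩ := IsAlgClosed.exists_pow_nat_eq q (n := 2) (by norm_num)
    have hz0 : z ≠ 0 := by rintro rfl; apply hq; rw [← hz]; simp
    have hz1 : ‖z‖ < 1 := by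
      by_contra hn
      have h2 : (1 : ℝ) ≤ ‖z‖ ^ 2 := one_le_pow₀ (not_lt.1 hn)
      rw [← norm_pow, hz] at h2
      linarith
    have h := hasSum_odd (fun n => (b n : ℂ)) z _ _ (hB z hz1) (hB (-z) (by simpa using hz1))
    rw [idOdd hz0 hz1, hz] at h
    have h3 := h.div_const z
    have e1 : 2 * z * Ef q / 2 / z = Ef q := by field_simp
    rw [e1] at h3
    refine hs_congr h3 (fun m => ?_) rfl
    rw [pow_succ, pow_mul, hz]
    field_simp
  set d : ℕ → ℤ := fun n => if n = 0 then 0 else b (2 * n - 1) with hd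
  have hmain : ∀ᶠ q : ℂ in nhds 0, q ≠ 0 →
      HasSum (fun n => ((b (4 * n + 1) : ℂ) - c n + 2 * d n) * (q ^ 2) ^ n) 0 := by
    filter_upwards [small_ne, Metric.ball_mem_nhds (0 : ℂ) one_pos] with q hne hq1 hq
    have h1 : ‖q‖ < 1 := by simpa using hq1
    have h2 := npow_lt h1 (k := 2) (by norm_num)
    have s1 := hasSum_even (fun m => (b (2 * m + 1) : ℂ)) q _ _ (hE q hq h1)
      (hE (-q) (neg_ne_zero.2 hq) (by simpa using h1))
    rw [idEven hq h1 hne] at s1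
    have s2 := hC (q ^ 2) h2
    simp only [← pow_mul (q) 2 5] at s2
    norm_num at s2
    have s3 : HasSum (fun n => (d n : ℂ) * (q ^ 2) ^ n) (q ^ 2 * Ef (q ^ 2)) := by
      have s4 := (hE (q ^ 2) (pow_ne_zero _ hq) h2).mul_left (q ^ 2)
      rw [← (add_left_injective 1).hasSum_iff]
      · refine hs_congr s4 (fun m => ?_) rfl
        simp only [Function.comp, hd]
        have : 2 * (m + 1) - 1 = 2 * m + 1 := by omega
        rw [if_neg (by omega), this]
        ring
      · intro n hn
        have : n = 0 := by
          by_contra h0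
          exact hn ⟨n - 1, by simp only; omega⟩
        simp [hd, this]
    have s5 := (s1.sub s2).add (s3.mul_left 2)
    refine hs_congr s5 (fun n => ?_) ?_
    · have : 2 * (2 * n) + 1 = 4 * n + 1 := by ring
      rw [this]; ring
    · ring
  have hall : ∀ᶠ z : ℂ in nhds 0, z ≠ 0 →
      HasSum (fun n => ((b (4 * n + 1) : ℂ) - c n + 2 * d n) * z ^ n) 0 := by
    rw [Metric.eventually_nhds_iff] at hmain ⊢
    obtain ⟨ε, hε, H⟩ := hmain
    refine ⟨ε ^ 2, by positivity, fun z hz hz0 => ?_⟩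
    obtain ⟨w, hw⟩ := IsAlgClosed.exists_pow_nat_eq z (n := 2) (by norm_num)
    have hw0 : w ≠ 0 := by rintro rfl; apply hz0; rw [← hw]; simp
    have hwε : ‖w‖ < ε := by
      rw [dist_zero_right, ← hw, norm_pow] at hz
      exact lt_of_pow_lt_pow_left₀ 2 hε.le hz
    have := H (y := w) (by simpa using hwε) hw0
    rwa [hw] at this
  intro n hn
  have h := coeff_zero _ hall n
  have h' : b (4 * n + 1) - c n + 2 * d n = 0 := by exact_mod_cast h
  simp only [hd, if_neg hn.ne'] at h'
  linarith
end
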